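/- There exists a universal constant C > 0 (independent of ε) such that for every ε > 0, every choice of sign ±, and every Schwartz function f on ℝ × ℝ³, the function v(t,x) = ∫_0^t ( ∫_{ℝ³} exp(i x·ξ ± i ((t−t')/ε) ξ₃/|ξ|) (𝓕_x f(t',·))(ξ) dξ ) dt' satisfies ‖v‖_{L⁶(ℝ_t × ℝ³_x)} ≤ C ε^{1/6} ∫_ℝ ‖f(t',·)‖_{Ḣ¹} dt'. -/

import Mathlib

open MeasureTheory Complex
open scoped ENNReal RealInnerProductSpace

noncomputable section

/-- Fourier transform `f̂(ξ) = ∫ e^{-i x·ξ} f(x) dx` on `ℝⁿ`. -/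
def fourierTf {n : ℕ} (f : EuclideanSpace ℝ (Fin n) → ℂ) (ξ : EuclideanSpace ℝ (Fin n)) : ℂ :=
  ∫ x : EuclideanSpace ℝ (Fin n), Complex.exp (-Complex.I * Complex.ofReal ⟪x, ξ⟫) * f x

/-- Homogeneous Sobolev norm `‖f‖_{Ḣˢ}` on `ℝⁿ`. -/
def sobolevNorm {n : ℕ} (s : ℝ) (f : EuclideanSpace ℝ (Fin n) → ℂ) : ℝ :=
  (∫ ξ : EuclideanSpace ℝ (Fin n), ‖ξ‖ ^ (2 * s) * ‖fourierTf f ξ‖ ^ 2) ^ (1 / 2 : ℝ)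

/-- The rotation dispersion relation `ξ₃ / |ξ|`. -/
def pRot (ξ : EuclideanSpace ℝ (Fin 3)) : ℝ :=
  ξ 2 / ‖ξ‖



/-- The one-dimensional Riesz kernel `|s|^{-1/3}`. -/
def rieszK (s : ℝ) : ℝ≥0∞ := ‖s‖ₑ ^ (-(1/3) : ℝ)

lemma measurable_rieszK : Measurable rieszK := by
  unfold rieszK; fun_prop

lemma rieszK_neg (s : ℝ) : rieszK (-s) = rieszK s := by
  simp [rieszK]

lemma lintegral_rpow_Ioc (L s : ℝ) (hL : 0 < L) (hs : -1 < s) :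
    ∫⁻ z in Set.Ioc 0 L, ENNReal.ofReal (z ^ s) = ENNReal.ofReal (L ^ (s+1) / (s+1)) := by
  have hi : IntervalIntegrable (fun z : ℝ => z ^ s) volume 0 L :=
    intervalIntegral.intervalIntegrable_rpow' hs
  rw [← ofReal_integral_eq_lintegral_ofReal]
  · rw [← intervalIntegral.integral_of_le hL.le, integral_rpow (Or.inl hs),
      Real.zero_rpow (by linarith), sub_zero]
  · exact (intervalIntegrable_iff_integrableOn_Ioc_of_le hL.le).1 hi
  · filter_upwards [ae_restrict_mem measurableSet_Ioc] with z hz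
    exact Real.rpow_nonneg hz.1.le _

lemma lintegral_rieszK_Icc (R : ℝ) (hR : 0 < R) :
    ∫⁻ z in Set.Icc (-R) R, rieszK z ≤ ENNReal.ofReal (3 * R ^ (2/3 : ℝ)) := by
  have h1 : ∫⁻ z in Set.Ioc 0 R, rieszK z = ENNReal.ofReal (3/2 * R ^ (2/3 : ℝ)) := by
    have := lintegral_rpow_Ioc R (-(1/3)) hR (by norm_num)
    rw [show (-(1/3) + 1 : ℝ) = 2/3 by norm_num] at this
    rw [show 3/2 * R ^ (2/3 : ℝ) = R ^ (2/3 : ℝ) / (2/3) by ring, ← this]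
    apply setLIntegral_congr_fun measurableSet_Ioc
    intro z hz
    simp only [rieszK]
    rw [Real.enorm_eq_ofReal hz.1.le, ENNReal.ofReal_rpow_of_pos hz.1]
  have h2 : ∫⁻ z in Set.Ico (-R) 0, rieszK z = ∫⁻ z in Set.Ioc 0 R, rieszK z := by
    rw [← lintegral_indicator measurableSet_Ico, ← lintegral_indicator measurableSet_Ioc,
      ← lintegral_neg_eq_self]
    congr 1
    ext z
    simp only [Set.indicator, Set.mem_Ico, Set.mem_Ioc, rieszK_neg]
    congr 1
    simp only [eq_iff_iff]
    constructor <;> rintro ⟨h, h'⟩ <;> constructor <;> linarith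
  have h3 : Set.Icc (-R) R ⊆ Set.Ico (-R) 0 ∪ ({0} ∪ Set.Ioc 0 R) := by
    intro z hz
    rcases lt_trichotomy z 0 with h | h | h
    · left; exact ⟨hz.1, h⟩
    · right; left; exact h
    · right; right; exact ⟨h, hz.2⟩
  calc _ ≤ ∫⁻ z in Set.Ico (-R) 0 ∪ ({0} ∪ Set.Ioc 0 R), rieszK z := lintegral_mono_set h3
    _ ≤ (∫⁻ z in Set.Ico (-R) 0, rieszK z) + ((∫⁻ z in ({0} : Set ℝ), rieszK z) +
        ∫⁻ z in Set.Ioc 0 R, rieszK z) := by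
        refine (lintegral_union_le _ _ _).trans ?_
        gcongr
        exact lintegral_union_le _ _ _
    _ = ENNReal.ofReal (3/2 * R ^ (2/3 : ℝ)) + ENNReal.ofReal (3/2 * R ^ (2/3 : ℝ)) := by
        rw [h2, h1]; simp
    _ = _ := by
        rw [← ENNReal.ofReal_add (by positivity) (by positivity)]; congr 1; ring

lemma setLIntegral_rieszK_le (F : Set ℝ) (x : ℝ) :
    ∫⁻ y in F, rieszK (x - y) ≤ 4 * (volume F) ^ (2/3 : ℝ) := by
  by_cases h0 : volume F = 0
  · rw [Measure.restrict_eq_zero.2 h0]; simp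
  by_cases ht : volume F = ⊤
  · rw [ht, ENNReal.top_rpow_of_pos (by norm_num)]; simp
  set R := (volume F).toReal with hRdef
  have hR : 0 < R := ENNReal.toReal_pos h0 ht
  have hv : volume F = ENNReal.ofReal R := (ENNReal.ofReal_toReal ht).symm
  have hpt : ∀ y, rieszK (x - y) ≤
      (Set.Icc (-R) R).indicator rieszK (x - y) + ENNReal.ofReal (R ^ (-(1/3) : ℝ)) := by
    intro y
    by_cases hy : x - y ∈ Set.Icc (-R) R
    · rw [Set.indicator_of_mem hy]; exact le_self_add
    · rw [Set.indicator_of_notMem hy, zero_add, rieszK]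
      have : R ≤ |x - y| := by
        by_contra! h
        exact hy (abs_le.1 h.le)
      rw [← ENNReal.ofReal_rpow_of_pos hR]
      rw [Real.enorm_eq_ofReal_abs, ENNReal.rpow_neg, ENNReal.rpow_neg]
      gcongr
  calc _ ≤ ∫⁻ y in F, ((Set.Icc (-R) R).indicator rieszK (x - y) +
        ENNReal.ofReal (R ^ (-(1/3) : ℝ))) := lintegral_mono hpt
    _ = (∫⁻ y in F, (Set.Icc (-R) R).indicator rieszK (x - y)) +
        ENNReal.ofReal (R ^ (-(1/3) : ℝ)) * volume F := by
        rw [lintegral_add_right _ measurable_const]; simp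
    _ ≤ (∫⁻ y, (Set.Icc (-R) R).indicator rieszK (x - y)) +
        ENNReal.ofReal (R ^ (-(1/3) : ℝ)) * volume F := by
        gcongr; exact Measure.restrict_le_self
    _ ≤ ENNReal.ofReal (3 * R ^ (2/3 : ℝ)) + ENNReal.ofReal (R ^ (2/3 : ℝ)) := by
        gcongr
        · rw [lintegral_sub_left_eq_self (fun y => (Set.Icc (-R) R).indicator rieszK y) x,
            lintegral_indicator measurableSet_Icc]
          exact lintegral_rieszK_Icc R hR
        · rw [hv, ← ENNReal.ofReal_mul (by positivity)]
          apply ENNReal.ofReal_le_ofReal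
          nth_rewrite 2 [← Real.rpow_one R]
          rw [← Real.rpow_add hR]; norm_num
    _ = _ := by
        rw [← ENNReal.ofReal_add (by positivity) (by positivity), hv,
          ENNReal.ofReal_rpow_of_pos hR, show (4 : ℝ≥0∞) = ENNReal.ofReal 4 by simp,
          ← ENNReal.ofReal_mul (by norm_num)]
        congr 1; ring

lemma layer_eq (y : ℝ≥0∞) :
    ∫⁻ a in Set.Ioi (0:ℝ), (if ENNReal.ofReal a < y then (1:ℝ≥0∞) else 0) = y := by
  have hm : MeasurableSet {a : ℝ | ENNReal.ofReal a < y} :=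
    measurableSet_lt (by fun_prop) measurable_const
  have : (fun a : ℝ => if ENNReal.ofReal a < y then (1:ℝ≥0∞) else 0) =
      {a : ℝ | ENNReal.ofReal a < y}.indicator 1 := by
    ext a; simp [Set.indicator]
  rw [this, lintegral_indicator hm]
  simp only [Pi.one_apply, lintegral_one, Measure.restrict_apply_univ,
    Measure.restrict_apply hm]
  induction y with
  | top => simp
  | coe y =>
    have : {a : ℝ | ENNReal.ofReal a < (y:ℝ≥0∞)} ∩ Set.Ioi 0 = Set.Ioo 0 (y:ℝ) := by
      ext a
      simp only [Set.mem_inter_iff, Set.mem_ofPred_eq, Set.mem_Ioi, Set.mem_Ioo]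
      constructor
      · rintro ⟨h, h0⟩
        refine ⟨h0, ?_⟩
        have := (ENNReal.ofReal_lt_iff_lt_toReal h0.le (by simp)).1 h
        simpa using this
      · rintro ⟨h0, h⟩
        exact ⟨(ENNReal.ofReal_lt_iff_lt_toReal h0.le (by simp)).2 (by simpa using h), h0⟩
    rw [this, Real.volume_Ioo]; simp

lemma layer_weight (y : ℝ≥0∞) :
    ∫⁻ a in Set.Ioi (0:ℝ), (if ENNReal.ofReal a < y then (1:ℝ≥0∞) else 0) *
      ENNReal.ofReal a ^ (1/5 : ℝ) ≤ y ^ (6/5 : ℝ) := by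
  by_cases hy : y = ⊤
  · rw [hy, ENNReal.top_rpow_of_pos (by norm_num)]; exact le_top
  by_cases hy0 : y = 0
  · simp [hy0]
  calc _ ≤ ∫⁻ a in Set.Ioi (0:ℝ), (if ENNReal.ofReal a < y then (1:ℝ≥0∞) else 0) *
      y ^ (1/5 : ℝ) := by
        apply lintegral_mono
        intro a
        dsimp only
        split_ifs with h
        · gcongr
        · simp
    _ = y * y ^ (1/5 : ℝ) := by
        rw [lintegral_mul_const' _ _ (by simp [hy]), layer_eq]
    _ = _ := by
        nth_rewrite 1 [← ENNReal.rpow_one y]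
        rw [← ENNReal.rpow_add _ _ hy0 hy]; norm_num

/-- Superlevel distribution function. -/
def distrF (f : ℝ → ℝ≥0∞) (a : ℝ) : ℝ≥0∞ := volume {x | ENNReal.ofReal a < f x}

lemma distrF_eq (f : ℝ → ℝ≥0∞) (hf : Measurable f) (a : ℝ) :
    distrF f a = ∫⁻ x, (if ENNReal.ofReal a < f x then (1:ℝ≥0∞) else 0) := by
  have hm : MeasurableSet {x : ℝ | ENNReal.ofReal a < f x} := measurableSet_lt measurable_const hf
  rw [distrF, ← lintegral_indicator_one hm]
  apply lintegral_congr
  intro x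
  simp [Set.indicator]

lemma measurable_lev (f : ℝ → ℝ≥0∞) (hf : Measurable f) :
    Measurable (fun p : ℝ × ℝ => if ENNReal.ofReal p.1 < f p.2 then (1:ℝ≥0∞) else 0) :=
  Measurable.ite (measurableSet_lt (by fun_prop) (by fun_prop)) measurable_const measurable_const

lemma measurable_distrF (f : ℝ → ℝ≥0∞) (hf : Measurable f) : Measurable (distrF f) := by
  have : distrF f = fun a => ∫⁻ x, (if ENNReal.ofReal a < f x then (1:ℝ≥0∞) else 0) := by
    ext a; exact distrF_eq f hf a
  rw [this]
  exact (measurable_lev f hf).lintegral_prod_right'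

lemma distrF_weight (f : ℝ → ℝ≥0∞) (hf : Measurable f) :
    ∫⁻ a in Set.Ioi (0:ℝ), distrF f a * ENNReal.ofReal a ^ (1/5 : ℝ) ≤
      ∫⁻ x, f x ^ (6/5 : ℝ) := by
  have hm : Measurable (fun p : ℝ × ℝ => (if ENNReal.ofReal p.1 < f p.2 then (1:ℝ≥0∞) else 0) *
      ENNReal.ofReal p.1 ^ (1/5 : ℝ)) := (measurable_lev f hf).mul (by fun_prop)
  calc _ = ∫⁻ a in Set.Ioi (0:ℝ), ∫⁻ x, (if ENNReal.ofReal a < f x then (1:ℝ≥0∞) else 0) *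
      ENNReal.ofReal a ^ (1/5 : ℝ) := by
        apply lintegral_congr
        intro a
        rw [lintegral_mul_const', distrF_eq f hf]
        exact ENNReal.rpow_ne_top_of_nonneg (by norm_num) (by simp)
    _ = ∫⁻ x, ∫⁻ a in Set.Ioi (0:ℝ), (if ENNReal.ofReal a < f x then (1:ℝ≥0∞) else 0) *
      ENNReal.ofReal a ^ (1/5 : ℝ) := lintegral_lintegral_swap hm.aemeasurable
    _ ≤ _ := lintegral_mono fun x => layer_weight (f x)

lemma inner_holder (γ : ℝ → ℝ≥0∞) (hγ : Measurable γ) (L : ℝ) (hL : 0 < L) :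
    ∫⁻ b in Set.Ioc 0 L, γ b ^ (2/3 : ℝ) ≤
      2 * (∫⁻ b in Set.Ioi (0:ℝ), γ b * ENNReal.ofReal b ^ (1/5 : ℝ)) ^ (2/3 : ℝ) *
        ENNReal.ofReal L ^ (1/5 : ℝ) := by
  have hc : (3/2 : ℝ).HolderConjugate 3 := by
    rw [Real.holderConjugate_iff]; norm_num
  have h := ENNReal.lintegral_mul_le_Lp_mul_Lq (volume.restrict (Set.Ioc 0 L)) hc
    (f := fun b => (γ b * ENNReal.ofReal b ^ (1/5 : ℝ)) ^ (2/3 : ℝ))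
    (g := fun b => ENNReal.ofReal b ^ (-(2/15) : ℝ)) (by fun_prop) (by fun_prop)
  have e1 : ∫⁻ b in Set.Ioc 0 L, γ b ^ (2/3 : ℝ) = ∫⁻ b in Set.Ioc 0 L,
      ((fun b => (γ b * ENNReal.ofReal b ^ (1/5 : ℝ)) ^ (2/3 : ℝ)) *
        (fun b => ENNReal.ofReal b ^ (-(2/15) : ℝ))) b := by
    apply setLIntegral_congr_fun measurableSet_Ioc
    intro b hb
    have hb0 : ENNReal.ofReal b ≠ 0 := by simpa using hb.1
    simp only [Pi.mul_apply]
    rw [ENNReal.mul_rpow_of_nonneg _ _ (by norm_num), mul_assoc, ← ENNReal.rpow_mul,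
      ← ENNReal.rpow_add _ _ hb0 (by simp)]
    norm_num
  rw [e1]
  refine h.trans ?_
  simp only [← ENNReal.rpow_mul]
  norm_num only [ENNReal.rpow_one]
  have e2 : ∫⁻ b in Set.Ioc 0 L, ENNReal.ofReal b ^ (-2/5 : ℝ) =
      ENNReal.ofReal (L ^ (3/5 : ℝ) / (3/5)) := by
    have := lintegral_rpow_Ioc L (-2/5) hL (by norm_num)
    norm_num only at this
    norm_num only
    rw [← this]
    apply setLIntegral_congr_fun measurableSet_Ioc
    intro z hz
    dsimp only
    rw [ENNReal.ofReal_rpow_of_pos hz.1]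
  have e2' := e2
  norm_num only at e2'
  rw [e2']
  have e3 : ENNReal.ofReal (L ^ (3/5 : ℝ) / (3/5)) ^ (1/3 : ℝ) ≤
      2 * ENNReal.ofReal L ^ (1/5 : ℝ) := by
    calc _ ≤ (8 * ENNReal.ofReal L ^ (3/5 : ℝ)) ^ (1/3 : ℝ) := by
          gcongr
          rw [ENNReal.ofReal_rpow_of_pos hL, show (8 : ℝ≥0∞) = ENNReal.ofReal 8 by simp,
            ← ENNReal.ofReal_mul (by norm_num)]
          apply ENNReal.ofReal_le_ofReal
          have : 0 < L ^ (3/5 : ℝ) := by positivity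
          linarith
      _ = _ := by
          rw [ENNReal.mul_rpow_of_nonneg _ _ (by norm_num), ← ENNReal.rpow_mul]
          norm_num only
          congr 1
          rw [show (8:ℝ≥0∞) = 2 ^ (3:ℝ) by norm_num, ← ENNReal.rpow_mul]
          norm_num
  calc _ ≤ (∫⁻ b in Set.Ioi (0:ℝ), γ b * ENNReal.ofReal b ^ (1/5 : ℝ)) ^ (2/3 : ℝ) *
        (2 * ENNReal.ofReal L ^ (1/5 : ℝ)) := by
        gcongr
        exact Set.Ioc_subset_Ioi_self
    _ = _ := by ring

lemma half_bound (φ γ : ℝ → ℝ≥0∞) (hφ : Measurable φ) (hγ : Measurable γ) (κ : ℝ) (hκ : 0 < κ) :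
    ∫⁻ a in Set.Ioi (0:ℝ), φ a * ∫⁻ b in Set.Ioc 0 (κ * a), γ b ^ (2/3 : ℝ) ≤
      2 * ENNReal.ofReal κ ^ (1/5 : ℝ) *
      (∫⁻ a in Set.Ioi (0:ℝ), φ a * ENNReal.ofReal a ^ (1/5 : ℝ)) *
      (∫⁻ b in Set.Ioi (0:ℝ), γ b * ENNReal.ofReal b ^ (1/5 : ℝ)) ^ (2/3 : ℝ) := by
  set Q := (∫⁻ b in Set.Ioi (0:ℝ), γ b * ENNReal.ofReal b ^ (1/5 : ℝ)) ^ (2/3 : ℝ)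
  calc _ ≤ ∫⁻ a in Set.Ioi (0:ℝ), (2 * ENNReal.ofReal κ ^ (1/5 : ℝ) * Q) *
        (φ a * ENNReal.ofReal a ^ (1/5 : ℝ)) := by
        apply setLIntegral_mono (by fun_prop)
        intro a ha
        calc _ ≤ φ a * (2 * Q * ENNReal.ofReal (κ * a) ^ (1/5 : ℝ)) := by
              gcongr
              exact inner_holder γ hγ _ (mul_pos hκ ha)
          _ = _ := by
              rw [ENNReal.ofReal_mul hκ.le, ENNReal.mul_rpow_of_nonneg _ _ (by norm_num)]
              ring
    _ = _ := by
        rw [lintegral_const_mul _ (by fun_prop)]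
        ring


/-- Superlevel indicator. -/
def lev (f : ℝ → ℝ≥0∞) (a x : ℝ) : ℝ≥0∞ := if ENNReal.ofReal a < f x then 1 else 0

lemma measurable_lev' (f : ℝ → ℝ≥0∞) (hf : Measurable f) :
    Measurable (fun p : ℝ × ℝ => lev f p.1 p.2) := measurable_lev f hf

lemma measurable_lev_right (f : ℝ → ℝ≥0∞) (hf : Measurable f) (a : ℝ) :
    Measurable (lev f a) :=
  (measurable_lev' f hf).comp (measurable_const.prodMk measurable_id)

lemma layer_mul (f W : ℝ → ℝ≥0∞) (hf : Measurable f) (hW : Measurable W) :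
    ∫⁻ x, f x * W x = ∫⁻ a in Set.Ioi (0:ℝ), ∫⁻ x, lev f a x * W x := by
  have hm := measurable_lev' f hf
  rw [lintegral_lintegral_swap]
  · apply lintegral_congr
    intro x
    rw [lintegral_mul_const]
    · congr 1
      exact (layer_eq (f x)).symm
    · exact hm.comp (measurable_id.prodMk measurable_const)
  · exact (hm.mul (hW.comp measurable_snd)).aemeasurable

lemma lev_mul_bound (f W : ℝ → ℝ≥0∞) (hf : Measurable f) (a : ℝ) (M : ℝ≥0∞)
    (hW : ∀ x, W x ≤ M) : ∫⁻ x, lev f a x * W x ≤ distrF f a * M := by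
  calc _ ≤ ∫⁻ x, lev f a x * M := by gcongr; exact hW _
    _ = _ := by
      rw [lintegral_mul_const _ (measurable_lev_right f hf a), distrF_eq f hf]; rfl

lemma lev_rieszK (f : ℝ → ℝ≥0∞) (hf : Measurable f) (a y : ℝ) :
    ∫⁻ x, lev f a x * rieszK (y - x) ≤ 4 * distrF f a ^ (2/3 : ℝ) := by
  have hm : MeasurableSet {x : ℝ | ENNReal.ofReal a < f x} := measurableSet_lt measurable_const hf
  refine le_trans (le_of_eq ?_) (setLIntegral_rieszK_le {x : ℝ | ENNReal.ofReal a < f x} y)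
  rw [← lintegral_indicator hm]
  apply lintegral_congr
  intro x
  by_cases h : ENNReal.ofReal a < f x <;> simp [lev, Set.indicator, h]

lemma measurable_rk : Measurable (fun p : ℝ × ℝ => rieszK (p.1 - p.2)) :=
  measurable_rieszK.comp (by fun_prop)

lemma rieszK_comm (x y : ℝ) : rieszK (x - y) = rieszK (y - x) := by
  rw [← rieszK_neg, neg_sub]

lemma hls_kappa (f g : ℝ → ℝ≥0∞) (hf : Measurable f) (hg : Measurable g) (κ : ℝ) (hκ : 0 < κ) :
    ∫⁻ x, ∫⁻ y, f x * g y * rieszK (x - y) ≤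
      8 * (ENNReal.ofReal κ ^ (1/5 : ℝ) * (∫⁻ x, f x ^ (6/5 : ℝ)) *
        (∫⁻ x, g x ^ (6/5 : ℝ)) ^ (2/3 : ℝ) +
      ENNReal.ofReal κ⁻¹ ^ (1/5 : ℝ) * (∫⁻ x, g x ^ (6/5 : ℝ)) *
        (∫⁻ x, f x ^ (6/5 : ℝ)) ^ (2/3 : ℝ)) := by
  have hk := measurable_rk
  have hfl := fun a => measurable_lev_right f hf a
  have hgl := fun a => measurable_lev_right g hg a
  have hφ := measurable_distrF f hf
  have hγ := measurable_distrF g hg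
  have hW : Measurable (fun x => ∫⁻ y, g y * rieszK (x - y)) :=
    Measurable.lintegral_prod_right' (f := fun p : ℝ × ℝ => g p.2 * rieszK (p.1 - p.2))
      ((hg.comp measurable_snd).mul hk)
  have hV : ∀ a, Measurable (fun y => ∫⁻ x, lev f a x * rieszK (x - y)) := fun a =>
    Measurable.lintegral_prod_left' (f := fun p : ℝ × ℝ => lev f a p.1 * rieszK (p.1 - p.2))
      (((hfl a).comp measurable_fst).mul hk)
  have e1 : ∫⁻ x, ∫⁻ y, f x * g y * rieszK (x - y) =
      ∫⁻ a in Set.Ioi (0:ℝ), ∫⁻ b in Set.Ioi (0:ℝ), ∫⁻ y, lev g b y *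
        ∫⁻ x, lev f a x * rieszK (x - y) := by
    calc _ = ∫⁻ x, f x * ∫⁻ y, g y * rieszK (x - y) := by
          apply lintegral_congr; intro x
          rw [← lintegral_const_mul]
          · simp_rw [mul_assoc]
          · exact hg.mul (hk.comp (measurable_const.prodMk measurable_id))
      _ = ∫⁻ a in Set.Ioi (0:ℝ), ∫⁻ x, lev f a x * ∫⁻ y, g y * rieszK (x - y) :=
          layer_mul f _ hf hW
      _ = _ := by
          apply lintegral_congr; intro a
          rw [← layer_mul g _ hg (hV a)]
          calc _ = ∫⁻ x, ∫⁻ y, lev f a x * (g y * rieszK (x - y)) := by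
                apply lintegral_congr; intro x
                rw [← lintegral_const_mul]
                exact hg.mul (hk.comp (measurable_const.prodMk measurable_id))
            _ = ∫⁻ y, ∫⁻ x, lev f a x * (g y * rieszK (x - y)) :=
                lintegral_lintegral_swap (((hfl a).comp measurable_fst).mul
                  ((hg.comp measurable_snd).mul hk)).aemeasurable
            _ = _ := by
                apply lintegral_congr; intro y
                rw [← lintegral_const_mul]
                · apply lintegral_congr; intro x; ring
                · exact (hfl a).mul (hk.comp (measurable_id.prodMk measurable_const))
  have b1 : ∀ a b, ∫⁻ y, lev g b y * ∫⁻ x, lev f a x * rieszK (x - y) ≤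
      distrF g b * (4 * distrF f a ^ (2/3 : ℝ)) := by
    intro a b
    apply lev_mul_bound g _ hg
    intro y
    simp_rw [rieszK_comm _ y]
    exact lev_rieszK f hf a y
  have b2 : ∀ a b, ∫⁻ y, lev g b y * ∫⁻ x, lev f a x * rieszK (x - y) ≤
      distrF f a * (4 * distrF g b ^ (2/3 : ℝ)) := by
    intro a b
    calc _ = ∫⁻ y, ∫⁻ x, lev g b y * (lev f a x * rieszK (x - y)) := by
          apply lintegral_congr; intro y
          rw [← lintegral_const_mul]
          exact (hfl a).mul (hk.comp (measurable_id.prodMk measurable_const))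
      _ = ∫⁻ x, ∫⁻ y, lev g b y * (lev f a x * rieszK (x - y)) := by
          apply lintegral_lintegral_swap
          exact (((hgl b).comp measurable_fst).mul (((hfl a).comp measurable_snd).mul
            (hk.comp measurable_swap))).aemeasurable
      _ = ∫⁻ x, lev f a x * ∫⁻ y, lev g b y * rieszK (x - y) := by
          apply lintegral_congr; intro x
          rw [← lintegral_const_mul]
          · apply lintegral_congr; intro y; ring
          · exact (hgl b).mul (hk.comp (measurable_const.prodMk measurable_id))
      _ ≤ _ := by
          apply lev_mul_bound f _ hf
          intro x
          exact lev_rieszK g hg b x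
  rw [e1]
  have hcase : ∀ a b : ℝ, ∫⁻ y, lev g b y * ∫⁻ x, lev f a x * rieszK (x - y) ≤
      4 * (if b ≤ κ * a then distrF f a * distrF g b ^ (2/3 : ℝ) else 0) +
      4 * (if a ≤ κ⁻¹ * b then distrF g b * distrF f a ^ (2/3 : ℝ) else 0) := by
    intro a b
    by_cases h : b ≤ κ * a
    · rw [if_pos h]
      refine (b2 a b).trans (le_trans (le_of_eq (by ring)) le_self_add)
    · have : a ≤ κ⁻¹ * b := by
        rw [le_inv_mul_iff₀ hκ]; exact (not_le.1 h).le
      rw [if_pos this]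
      refine (b1 a b).trans (le_trans (le_of_eq (by ring)) le_add_self)
  have mA : Measurable (fun p : ℝ × ℝ => if p.2 ≤ κ * p.1 then
      distrF f p.1 * distrF g p.2 ^ (2/3 : ℝ) else 0) :=
    Measurable.ite (measurableSet_le (by fun_prop) (by fun_prop)) (by fun_prop) measurable_const
  have mB : Measurable (fun p : ℝ × ℝ => if p.1 ≤ κ⁻¹ * p.2 then
      distrF g p.2 * distrF f p.1 ^ (2/3 : ℝ) else 0) :=
    Measurable.ite (measurableSet_le (by fun_prop) (by fun_prop)) (by fun_prop) measurable_const
  have fin : ∀ (φ γ : ℝ → ℝ≥0∞) (a κ : ℝ), Measurable γ →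
      ∫⁻ b in Set.Ioi (0:ℝ), (if b ≤ κ * a then φ a * γ b ^ (2/3 : ℝ) else 0) =
        φ a * ∫⁻ b in Set.Ioc 0 (κ * a), γ b ^ (2/3 : ℝ) := by
    intro φ γ a κ hγ
    rw [← lintegral_const_mul _ (by fun_prop), ← lintegral_indicator measurableSet_Ioi,
      ← lintegral_indicator measurableSet_Ioc]
    apply lintegral_congr
    intro b
    simp only [Set.indicator, Set.mem_Ioi, Set.mem_Ioc]
    by_cases h1 : 0 < b <;> by_cases h2 : b ≤ κ * a <;> simp [h1, h2]
  calc _ ≤ ∫⁻ a in Set.Ioi (0:ℝ), ∫⁻ b in Set.Ioi (0:ℝ),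
      (4 * (if b ≤ κ * a then distrF f a * distrF g b ^ (2/3 : ℝ) else 0) +
      4 * (if a ≤ κ⁻¹ * b then distrF g b * distrF f a ^ (2/3 : ℝ) else 0)) := by
        gcongr with a b; exact hcase a b
    _ = 4 * (∫⁻ a in Set.Ioi (0:ℝ), ∫⁻ b in Set.Ioi (0:ℝ),
        (if b ≤ κ * a then distrF f a * distrF g b ^ (2/3 : ℝ) else 0)) +
        4 * (∫⁻ a in Set.Ioi (0:ℝ), ∫⁻ b in Set.Ioi (0:ℝ),
        (if a ≤ κ⁻¹ * b then distrF g b * distrF f a ^ (2/3 : ℝ) else 0)) := by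
        rw [← lintegral_const_mul _ mA.lintegral_prod_right',
          ← lintegral_const_mul _ mB.lintegral_prod_right', ← lintegral_add_left]
        · apply lintegral_congr; intro a
          rw [← lintegral_const_mul, ← lintegral_const_mul, ← lintegral_add_left]
          · exact (mA.comp (measurable_const.prodMk measurable_id)).const_mul _
          · exact (mB.comp (measurable_const.prodMk measurable_id))
          · exact (mA.comp (measurable_const.prodMk measurable_id))
        · exact mA.lintegral_prod_right'.const_mul _
    _ = 4 * (∫⁻ a in Set.Ioi (0:ℝ), distrF f a * ∫⁻ b in Set.Ioc 0 (κ * a),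
          distrF g b ^ (2/3 : ℝ)) +
        4 * (∫⁻ b in Set.Ioi (0:ℝ), distrF g b * ∫⁻ a in Set.Ioc 0 (κ⁻¹ * b),
          distrF f a ^ (2/3 : ℝ)) := by
        congr 2
        · apply lintegral_congr; intro a; exact fin _ _ a κ hγ
        · rw [lintegral_lintegral_swap mB.aemeasurable]
          apply lintegral_congr; intro b; exact fin _ _ b κ⁻¹ hφ
    _ ≤ 4 * (2 * ENNReal.ofReal κ ^ (1/5 : ℝ) * (∫⁻ x, f x ^ (6/5 : ℝ)) *
        (∫⁻ x, g x ^ (6/5 : ℝ)) ^ (2/3 : ℝ)) +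
        4 * (2 * ENNReal.ofReal κ⁻¹ ^ (1/5 : ℝ) * (∫⁻ x, g x ^ (6/5 : ℝ)) *
        (∫⁻ x, f x ^ (6/5 : ℝ)) ^ (2/3 : ℝ)) := by
        gcongr
        · refine (half_bound _ _ hφ hγ κ hκ).trans ?_
          exact mul_le_mul' (mul_le_mul' le_rfl (distrF_weight f hf))
            (ENNReal.rpow_le_rpow (distrF_weight g hg) (by norm_num))
        · refine (half_bound _ _ hγ hφ κ⁻¹ (inv_pos.2 hκ)).trans ?_
          exact mul_le_mul' (mul_le_mul' le_rfl (distrF_weight g hg))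
            (ENNReal.rpow_le_rpow (distrF_weight f hf) (by norm_num))
    _ = _ := by ring

/-- One-dimensional Hardy-Littlewood-Sobolev inequality, exponents `6/5, 6/5, 1/3`. -/
lemma hls_one (f g : ℝ → ℝ≥0∞) (hf : Measurable f) (hg : Measurable g) :
    ∫⁻ x, ∫⁻ y, f x * g y * rieszK (x - y) ≤
      16 * ((∫⁻ x, f x ^ (6/5 : ℝ)) ^ (5/6 : ℝ) * (∫⁻ x, g x ^ (6/5 : ℝ)) ^ (5/6 : ℝ)) := by
  set P := ∫⁻ x, f x ^ (6/5 : ℝ) with hP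
  set Q := ∫⁻ x, g x ^ (6/5 : ℝ) with hQ
  by_cases hP0 : P = 0
  · have : ∀ᵐ x, f x = 0 := by
      have := (lintegral_eq_zero_iff (by fun_prop)).1 hP0
      filter_upwards [this] with x hx
      have p65 : ¬ ((6/5 : ℝ) < 0) := by norm_num
      simpa [ENNReal.rpow_eq_zero_iff, p65] using hx
    have e : ∫⁻ x, ∫⁻ y, f x * g y * rieszK (x - y) = 0 := by
      rw [← lintegral_zero (μ := (volume : Measure ℝ))]
      apply lintegral_congr_ae
      filter_upwards [this] with x hx
      simp [hx]
    rw [e]; exact zero_le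
  by_cases hQ0 : Q = 0
  · have : ∀ᵐ x, g x = 0 := by
      have := (lintegral_eq_zero_iff (by fun_prop)).1 hQ0
      filter_upwards [this] with x hx
      have p65 : ¬ ((6/5 : ℝ) < 0) := by norm_num
      simpa [ENNReal.rpow_eq_zero_iff, p65] using hx
    have e : ∫⁻ x, ∫⁻ y, f x * g y * rieszK (x - y) = 0 := by
      rw [← lintegral_zero (μ := (volume : Measure ℝ))]
      apply lintegral_congr; intro x
      rw [← lintegral_zero (μ := (volume : Measure ℝ))]
      apply lintegral_congr_ae
      filter_upwards [this] with x hx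
      simp [hx]
    rw [e]; exact zero_le
  have p56 : (0:ℝ) < 5/6 := by norm_num
  by_cases hPt : P = ⊤
  · rw [hPt, ENNReal.top_rpow_of_pos p56, ENNReal.top_mul, ENNReal.mul_top (by norm_num)]
    · exact le_top
    · simp [ENNReal.rpow_eq_zero_iff, hQ0, p56.le]
  by_cases hQt : Q = ⊤
  · rw [hQt, ENNReal.top_rpow_of_pos p56, ENNReal.mul_top, ENNReal.mul_top (by norm_num)]
    · exact le_top
    · simp [ENNReal.rpow_eq_zero_iff, hP0, p56.le]
  have hp : 0 < P.toReal := ENNReal.toReal_pos hP0 hPt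
  have hq : 0 < Q.toReal := ENNReal.toReal_pos hQ0 hQt
  set p := P.toReal
  set q := Q.toReal
  have eP : P = ENNReal.ofReal p := (ENNReal.ofReal_toReal hPt).symm
  have eQ : Q = ENNReal.ofReal q := (ENNReal.ofReal_toReal hQt).symm
  have hκ : 0 < (q / p) ^ (5/6 : ℝ) := by positivity
  refine (hls_kappa f g hf hg _ hκ).trans ?_
  rw [← hP, ← hQ, eP, eQ]
  have key : ∀ p q : ℝ, 0 < p → 0 < q → ((q / p) ^ (5/6 : ℝ)) ^ (1/5 : ℝ) * p * q ^ (2/3 : ℝ) =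
      p ^ (5/6 : ℝ) * q ^ (5/6 : ℝ) := by
    intro p q hp hq
    rw [← Real.rpow_mul (by positivity), Real.div_rpow hq.le hp.le]
    norm_num only
    have e1 : p ^ (5/6 : ℝ) = p / p ^ (1/6 : ℝ) := by
      rw [eq_div_iff (by positivity), ← Real.rpow_add hp]; norm_num
    have e2 : q ^ (5/6 : ℝ) = q ^ (1/6 : ℝ) * q ^ (2/3 : ℝ) := by
      rw [← Real.rpow_add hq]; norm_num
    rw [e1, e2]; ring
  have hinv : ((q / p) ^ (5/6 : ℝ))⁻¹ = (p / q) ^ (5/6 : ℝ) := by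
    rw [← Real.inv_rpow (by positivity), inv_div]
  rw [hinv]
  have h1 : ∀ p q : ℝ, 0 < p → 0 < q → ENNReal.ofReal ((q / p) ^ (5/6 : ℝ)) ^ (1/5 : ℝ) *
      ENNReal.ofReal p * ENNReal.ofReal q ^ (2/3 : ℝ) =
      ENNReal.ofReal p ^ (5/6 : ℝ) * ENNReal.ofReal q ^ (5/6 : ℝ) := by
    intro p q hp hq
    rw [ENNReal.ofReal_rpow_of_pos (by positivity), ENNReal.ofReal_rpow_of_pos hq,
      ENNReal.ofReal_rpow_of_pos hp, ENNReal.ofReal_rpow_of_pos hq,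
      ← ENNReal.ofReal_mul (by positivity), ← ENNReal.ofReal_mul (by positivity),
      ← ENNReal.ofReal_mul (by positivity), key p q hp hq]
  rw [h1 p q hp hq, h1 q p hq hp]
  apply le_of_eq
  ring

/-- `k` is an HLS kernel on `α × α` with constant `C`. -/
def IsHLS {α : Type*} [MeasureSpace α] (k : α → α → ℝ≥0∞) (C : ℝ≥0∞) : Prop :=
  Measurable (fun p : α × α => k p.1 p.2) ∧
  ∀ f g : α → ℝ≥0∞, Measurable f → Measurable g →
    ∫⁻ x, ∫⁻ y, f x * g y * k x y ≤
      C * ((∫⁻ x, f x ^ (6/5 : ℝ)) ^ (5/6 : ℝ) * (∫⁻ x, g x ^ (6/5 : ℝ)) ^ (5/6 : ℝ))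

lemma isHLS_rieszK : IsHLS (fun x y : ℝ => rieszK (x - y)) 16 := ⟨measurable_rk, hls_one⟩

lemma IsHLS.prod {α β : Type*} [MeasureSpace α] [MeasureSpace β]
    [SFinite (volume : Measure α)] [SFinite (volume : Measure β)]
    {k : α → α → ℝ≥0∞} {l : β → β → ℝ≥0∞} {C D : ℝ≥0∞} (hk : IsHLS k C) (hl : IsHLS l D) :
    IsHLS (fun p q : α × β => k p.1 q.1 * l p.2 q.2) (C * D) := by
  obtain ⟨mk, hk⟩ := hk
  obtain ⟨ml, hl⟩ := hl
  have mm : Measurable (fun p : (α × β) × (α × β) => k p.1.1 p.2.1 * l p.1.2 p.2.2) :=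
    (mk.comp (by fun_prop : Measurable (fun p : (α × β) × (α × β) => (p.1.1, p.2.1)))).mul
    (ml.comp (by fun_prop : Measurable (fun p : (α × β) × (α × β) => (p.1.2, p.2.2))))
  refine ⟨mm, ?_⟩
  intro f g hf hg
  have mT : Measurable (fun p : (α × β) × (α × β) => f p.1 * g p.2 * (k p.1.1 p.2.1 * l p.1.2 p.2.2)) :=
    ((hf.comp measurable_fst).mul (hg.comp measurable_snd)).mul mm
  have nf : Measurable fun t => (∫⁻ x, f (t, x) ^ (6/5 : ℝ)) ^ (5/6 : ℝ) := by
    apply Measurable.pow_const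
    exact (hf.pow_const _).lintegral_prod_right'
  have ng : Measurable fun t => (∫⁻ x, g (t, x) ^ (6/5 : ℝ)) ^ (5/6 : ℝ) := by
    apply Measurable.pow_const
    exact (hg.pow_const _).lintegral_prod_right'
  have e0 : ∀ f : α × β → ℝ≥0∞, Measurable f →
      ∫⁻ t, ((∫⁻ x, f (t, x) ^ (6/5 : ℝ)) ^ (5/6 : ℝ)) ^ (6/5 : ℝ) = ∫⁻ p, f p ^ (6/5 : ℝ) := by
    intro f hf
    rw [Measure.volume_eq_prod, lintegral_prod _ (by fun_prop)]
    apply lintegral_congr; intro t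
    rw [← ENNReal.rpow_mul]; norm_num
  calc _ = ∫⁻ t, ∫⁻ x, ∫⁻ s, ∫⁻ y, f (t, x) * g (s, y) * (k t s * l x y) := by
        rw [Measure.volume_eq_prod, lintegral_prod _ (mT.lintegral_prod_right').aemeasurable]
        apply lintegral_congr; intro t
        apply lintegral_congr; intro x
        rw [lintegral_prod]
        exact (mT.comp (measurable_const.prodMk measurable_id)).aemeasurable
    _ = ∫⁻ t, ∫⁻ s, ∫⁻ x, ∫⁻ y, f (t, x) * g (s, y) * (k t s * l x y) := by
        apply lintegral_congr; intro t
        apply lintegral_lintegral_swap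
        apply Measurable.aemeasurable
        exact Measurable.lintegral_prod_right'
          (f := fun p : (β × α) × β => f (t, p.1.1) * g (p.1.2, p.2) * (k t p.1.2 * l p.1.1 p.2))
          (mT.comp (by fun_prop :
            Measurable (fun p : (β × α) × β => ((t, p.1.1), (p.1.2, p.2)))))
    _ ≤ ∫⁻ t, ∫⁻ s, D * (((∫⁻ x, f (t, x) ^ (6/5 : ℝ)) ^ (5/6 : ℝ) *
          (∫⁻ x, g (s, x) ^ (6/5 : ℝ)) ^ (5/6 : ℝ)) * k t s) := by
        gcongr with t s
        have h := hl (fun x => f (t, x)) (fun y => g (s, y)) (by fun_prop) (by fun_prop)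
        have mk' : Measurable (fun p : β × β => f (t, p.1) * g (s, p.2) * l p.1 p.2) :=
          ((hf.comp (by fun_prop)).mul (hg.comp (by fun_prop))).mul ml
        calc _ = k t s * ∫⁻ x, ∫⁻ y, f (t, x) * g (s, y) * l x y := by
              rw [← lintegral_const_mul _ mk'.lintegral_prod_right']
              apply lintegral_congr; intro x
              refine Eq.trans ?_ (lintegral_const_mul _
                (mk'.comp (measurable_const.prodMk measurable_id : Measurable (fun y => (x, y)))))
              apply lintegral_congr; intro y
              dsimp only [Function.comp]
              ring
          _ ≤ k t s * _ := mul_le_mul' le_rfl h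
          _ = _ := by ring
    _ = D * ∫⁻ t, ∫⁻ s, (((∫⁻ x, f (t, x) ^ (6/5 : ℝ)) ^ (5/6 : ℝ) *
          (∫⁻ x, g (s, x) ^ (6/5 : ℝ)) ^ (5/6 : ℝ)) * k t s) := by
        have mk' : Measurable (fun p : α × α => ((∫⁻ x, f (p.1, x) ^ (6/5 : ℝ)) ^ (5/6 : ℝ) *
          (∫⁻ x, g (p.2, x) ^ (6/5 : ℝ)) ^ (5/6 : ℝ)) * k p.1 p.2) :=
          ((nf.comp measurable_fst).mul (ng.comp measurable_snd)).mul mk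
        rw [← lintegral_const_mul _ mk'.lintegral_prod_right']
        apply lintegral_congr; intro x
        exact lintegral_const_mul _
          (mk'.comp (measurable_const.prodMk measurable_id : Measurable (fun y => (x, y))))
    _ ≤ D * (C * _) := mul_le_mul' le_rfl (hk _ _ nf ng)
    _ = _ := by
        rw [e0 f hf, e0 g hg]; ring

lemma IsHLS.of_equiv {α β : Type*} [MeasureSpace α] [MeasureSpace β]
    (e : α ≃ᵐ β) (he : MeasurePreserving e)
    {l : β → β → ℝ≥0∞} {D : ℝ≥0∞} (hl : IsHLS l D) :
    IsHLS (fun x y : α => l (e x) (e y)) D := by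
  obtain ⟨ml, hl⟩ := hl
  refine ⟨ml.comp (by fun_prop : Measurable (fun p : α × α => (e p.1, e p.2))), ?_⟩
  intro f g hf hg
  have h := hl (f ∘ e.symm) (g ∘ e.symm) (by fun_prop) (by fun_prop)
  have key : ∀ F : β → ℝ≥0∞, ∫⁻ b, F b = ∫⁻ a, F (e a) := fun F => by
    rw [← he.lintegral_comp_emb e.measurableEmbedding]
  simp only [key, Function.comp, MeasurableEquiv.symm_apply_apply] at h
  exact h

/-- Measurable identification of three-dimensional Euclidean space with a product. -/
def eucEquiv : EuclideanSpace ℝ (Fin 3) ≃ᵐ ℝ × (ℝ × ℝ) :=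
  ((MeasurableEquiv.toLp 2 (Fin 3 → ℝ)).symm.trans
    (MeasurableEquiv.piFinSuccAbove (fun _ => ℝ) 2)).trans
    ((MeasurableEquiv.refl ℝ).prodCongr (MeasurableEquiv.finTwoArrow))

lemma eucEquiv_apply (x : EuclideanSpace ℝ (Fin 3)) : eucEquiv x = (x 2, (x 0, x 1)) := rfl

lemma eucEquiv_symm_apply (p : ℝ × (ℝ × ℝ)) : eucEquiv.symm p = !₂[p.2.1, p.2.2, p.1] := by
  rw [MeasurableEquiv.symm_apply_eq, eucEquiv_apply]
  simp

lemma eucEquiv_mp : MeasurePreserving eucEquiv := by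
  refine MeasurePreserving.trans (μb := (volume : Measure (ℝ × (Fin 2 → ℝ)))) ?_ ?_
  · exact MeasurePreserving.trans (EuclideanSpace.volume_preserving_symm_measurableEquiv_toLp (Fin 3))
      (volume_preserving_piFinSuccAbove (fun _ => ℝ) 2)
  · exact (MeasurePreserving.id volume).prod (volume_preserving_finTwoArrow ℝ)

/-- The space-time HLS kernel. -/
def bigK (t : ℝ) (x : EuclideanSpace ℝ (Fin 3)) : ℝ≥0∞ :=
  rieszK t * (rieszK (x 2) * (rieszK (x 0) * rieszK (x 1)))

lemma isHLS_bigK : IsHLS (fun p q : ℝ × EuclideanSpace ℝ (Fin 3) => bigK (p.1 - q.1) (p.2 - q.2))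
    (16 * (16 * (16 * 16))) :=
  isHLS_rieszK.prod (IsHLS.of_equiv eucEquiv eucEquiv_mp
    (isHLS_rieszK.prod (isHLS_rieszK.prod isHLS_rieszK)))


lemma osc_far (h h' : ℝ → ℂ) (c q M τ : ℝ) (hc : 0 < c) (hcq : c ≤ q)
    (hd : ∀ u ∈ Set.Icc c q, HasDerivAt h (h' u) u) (hcont : ContinuousOn h' (Set.Icc c q))
    (hM : 0 ≤ M) (b1 : ∀ u ∈ Set.Icc c q, ‖h u‖ ≤ M * u ^ (-(2/3) : ℝ))
    (b2 : ∀ u ∈ Set.Icc c q, ‖h' u‖ ≤ M * u ^ (-(5/3) : ℝ)) (hτ : τ ≠ 0) :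
    ‖∫ u in c..q, Complex.exp (I * (τ * u : ℝ)) * h u‖ ≤
      |τ|⁻¹ * (7/2 * M * c ^ (-(2/3) : ℝ)) := by
  have hτc : (I * (τ : ℂ)) ≠ 0 := by simp [hτ]
  set E : ℝ → ℂ := fun u => Complex.exp (I * (τ * u : ℝ)) / (I * τ) with hE
  have hEd : ∀ u, HasDerivAt E (Complex.exp (I * (τ * u : ℝ))) u := by
    intro u
    have h1 : HasDerivAt (fun u : ℝ => (I * (τ * u : ℝ) : ℂ)) (I * τ) u := by
      have h2 : HasDerivAt (fun u : ℝ => ((τ * u : ℝ) : ℂ)) ((τ * 1 : ℝ) : ℂ) u :=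
        ((hasDerivAt_id u).const_mul τ).ofReal_comp
      simpa using h2.const_mul I
    have h3 := (h1.cexp).div_const (I * τ)
    rwa [mul_div_cancel_right₀ _ hτc] at h3
  have hEn : ∀ u, ‖E u‖ = |τ|⁻¹ := by
    intro u
    have : ‖Complex.exp (I * (τ * u : ℝ))‖ = 1 := by
      rw [mul_comm]; exact Complex.norm_exp_ofReal_mul_I _
    rw [hE]; dsimp only
    rw [norm_div, this, norm_mul, Complex.norm_I, Complex.norm_real]
    simp
  have ibp := intervalIntegral.integral_mul_deriv_eq_deriv_mul (a := c) (b := q)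
    (u := h) (u' := h') (v := E) (v' := fun u => Complex.exp (I * (τ * u : ℝ)))
    (by rw [Set.uIcc_of_le hcq]; exact hd) (fun u _ => hEd u)
    (by apply ContinuousOn.intervalIntegrable; rwa [Set.uIcc_of_le hcq])
    (by apply Continuous.intervalIntegrable; fun_prop)
  have e : ∫ u in c..q, Complex.exp (I * (τ * u : ℝ)) * h u =
      ∫ u in c..q, h u * Complex.exp (I * (τ * u : ℝ)) := by
    congr 1; ext u; ring
  rw [e, ibp]
  have hq : 0 < q := hc.trans_le hcq
  have n1 : ‖h q * E q‖ ≤ |τ|⁻¹ * (M * c ^ (-(2/3) : ℝ)) := by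
    rw [norm_mul, hEn, mul_comm]
    gcongr
    refine (b1 q ⟨hcq, le_rfl⟩).trans ?_
    gcongr 1
    exact Real.rpow_le_rpow_of_nonpos hc hcq (by norm_num)
  have n2 : ‖h c * E c‖ ≤ |τ|⁻¹ * (M * c ^ (-(2/3) : ℝ)) := by
    rw [norm_mul, hEn, mul_comm]
    gcongr
    exact b1 c ⟨le_rfl, hcq⟩
  have n3 : ‖∫ u in c..q, h' u * E u‖ ≤ |τ|⁻¹ * (3/2 * M * c ^ (-(2/3) : ℝ)) := by
    have hIntg : IntervalIntegrable (fun u : ℝ => u ^ (-(5/3) : ℝ)) volume c q :=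
      intervalIntegral.intervalIntegrable_rpow (Or.inr (by
        rw [Set.uIcc_of_le hcq]; intro h; exact absurd h.1 (not_le.2 hc)))
    calc _ ≤ ∫ u in c..q, |τ|⁻¹ * M * u ^ (-(5/3) : ℝ) := by
          apply intervalIntegral.norm_integral_le_of_norm_le hcq
          · apply Filter.Eventually.of_forall
            intro u hu
            rw [norm_mul, hEn]
            calc _ ≤ (M * u ^ (-(5/3) : ℝ)) * |τ|⁻¹ := by
                  gcongr; exact b2 u ⟨hu.1.le, hu.2⟩
              _ = _ := by ring
          · exact hIntg.const_mul _
      _ = |τ|⁻¹ * M * ((q ^ (-(2/3) : ℝ) - c ^ (-(2/3) : ℝ)) / (-(2/3))) := by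
          rw [intervalIntegral.integral_const_mul, integral_rpow]
          · norm_num
          · right
            refine ⟨by norm_num, ?_⟩
            rw [Set.uIcc_of_le hcq]; intro h; exact absurd h.1 (not_le.2 hc)
      _ ≤ _ := by
          rw [mul_assoc]
          gcongr |τ|⁻¹ * ?_
          rw [mul_comm (3/2 : ℝ), mul_assoc]
          gcongr
          have : 0 < q ^ (-(2/3) : ℝ) := by positivity
          linarith
  calc _ ≤ ‖h q * E q‖ + ‖h c * E c‖ + ‖∫ u in c..q, h' u * E u‖ :=
        (norm_sub_le _ _).trans (by gcongr; exact norm_sub_le _ _)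
    _ ≤ |τ|⁻¹ * (M * c ^ (-(2/3) : ℝ)) + |τ|⁻¹ * (M * c ^ (-(2/3) : ℝ)) +
        |τ|⁻¹ * (3/2 * M * c ^ (-(2/3) : ℝ)) := by gcongr
    _ = _ := by ring

lemma osc_half (h h' : ℝ → ℂ) (p q M τ : ℝ) (hp : 0 ≤ p) (hpq : p ≤ q)
    (hd : ∀ u ∈ Set.Icc p q, HasDerivAt h (h' u) u) (hcont : ContinuousOn h' (Set.Icc p q))
    (hM : 0 ≤ M) (b1 : ∀ u ∈ Set.Icc p q, 0 < u → ‖h u‖ ≤ M * u ^ (-(2/3) : ℝ))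
    (b2 : ∀ u ∈ Set.Icc p q, 0 < u → ‖h' u‖ ≤ M * u ^ (-(5/3) : ℝ)) (hτ : τ ≠ 0) :
    ‖∫ u in p..q, Complex.exp (I * (τ * u : ℝ)) * h u‖ ≤ 7 * M * |τ| ^ (-(1/3) : ℝ) := by
  have hτ' : 0 < |τ| := abs_pos.2 hτ
  set l := |τ|⁻¹ with hl
  have hl0 : 0 < l := inv_pos.2 hτ'
  set c := max p (min q l) with hc
  have hpc : p ≤ c := le_max_left _ _
  have hcq : c ≤ q := max_le hpq (min_le_left _ _)
  have hl13 : |τ| ^ (-(1/3) : ℝ) = l ^ (1/3 : ℝ) := by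
    rw [hl, Real.inv_rpow hτ'.le, Real.rpow_neg hτ'.le]
  have hco : ContinuousOn h (Set.Icc p q) := fun u hu => (hd u hu).continuousAt.continuousWithinAt
  have hcoe : ContinuousOn (fun u : ℝ => Complex.exp (I * (τ * u : ℝ)) * h u) (Set.Icc p q) :=
    (Continuous.continuousOn (by fun_prop)).mul hco
  have i1 : IntervalIntegrable (fun u : ℝ => Complex.exp (I * (τ * u : ℝ)) * h u) volume p c := by
    apply ContinuousOn.intervalIntegrable
    rw [Set.uIcc_of_le hpc]; exact hcoe.mono (Set.Icc_subset_Icc_right hcq)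
  have i2 : IntervalIntegrable (fun u : ℝ => Complex.exp (I * (τ * u : ℝ)) * h u) volume c q := by
    apply ContinuousOn.intervalIntegrable
    rw [Set.uIcc_of_le hcq]; exact hcoe.mono (Set.Icc_subset_Icc_left hpc)
  rw [← intervalIntegral.integral_add_adjacent_intervals i1 i2]
  have near : ‖∫ u in p..c, Complex.exp (I * (τ * u : ℝ)) * h u‖ ≤ 3 * M * l ^ (1/3 : ℝ) := by
    calc _ ≤ ∫ u in p..c, M * u ^ (-(2/3) : ℝ) := by
          apply intervalIntegral.norm_integral_le_of_norm_le hpc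
          · apply Filter.Eventually.of_forall
            intro u hu
            have : ‖Complex.exp (I * (τ * u : ℝ))‖ = 1 := by
              rw [mul_comm]; exact Complex.norm_exp_ofReal_mul_I _
            rw [norm_mul, this, one_mul]
            exact b1 u ⟨hu.1.le, hu.2.trans hcq⟩ (hp.trans_lt hu.1)
          · exact (intervalIntegral.intervalIntegrable_rpow' (by norm_num)).const_mul _
      _ = 3 * M * (c ^ (1/3 : ℝ) - p ^ (1/3 : ℝ)) := by
          rw [intervalIntegral.integral_const_mul, integral_rpow (Or.inl (by norm_num))]
          norm_num
          ring
      _ ≤ _ := by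
          gcongr
          have hp3 : 0 ≤ p ^ (1/3 : ℝ) := by positivity
          rcases le_total p (min q l) with h1 | h1
          · have : c ≤ l := by rw [hc, max_eq_right h1]; exact min_le_right _ _
            have : c ^ (1/3 : ℝ) ≤ l ^ (1/3 : ℝ) :=
              Real.rpow_le_rpow (hp.trans hpc) this (by norm_num)
            linarith
          · have : c = p := by rw [hc, max_eq_left h1]
            rw [this, sub_self]; positivity
  have far : ‖∫ u in c..q, Complex.exp (I * (τ * u : ℝ)) * h u‖ ≤ 7/2 * M * l ^ (1/3 : ℝ) := by
    by_cases hcl : l ≤ c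
    · have hc0 : 0 < c := hl0.trans_le hcl
      have := osc_far h h' c q M τ hc0 hcq
        (fun u hu => hd u ⟨hpc.trans hu.1, hu.2⟩) (hcont.mono (Set.Icc_subset_Icc_left hpc)) hM
        (fun u hu => b1 u ⟨hpc.trans hu.1, hu.2⟩ (hc0.trans_le hu.1))
        (fun u hu => b2 u ⟨hpc.trans hu.1, hu.2⟩ (hc0.trans_le hu.1)) hτ
      refine this.trans ?_
      rw [← hl]
      have e1 : c ^ (-(2/3) : ℝ) ≤ l ^ (-(2/3) : ℝ) :=
        Real.rpow_le_rpow_of_nonpos hl0 hcl (by norm_num)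
      have e2 : l * l ^ (-(2/3) : ℝ) = l ^ (1/3 : ℝ) := by
        nth_rewrite 1 [← Real.rpow_one l]
        rw [← Real.rpow_add hl0]; norm_num
      calc _ ≤ l * (7/2 * M * l ^ (-(2/3) : ℝ)) := by gcongr
        _ = 7/2 * M * (l * l ^ (-(2/3) : ℝ)) := by ring
        _ = _ := by rw [e2]
    · have : c = q := by
        rcases le_total q l with h1 | h1
        · rw [hc, min_eq_left h1, max_eq_right hpq]
        · exfalso; apply hcl; rw [hc, min_eq_right h1]; exact le_max_right _ _
      rw [this]; simp; positivity
  rw [hl13]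
  have : 0 ≤ M * l ^ (1/3 : ℝ) := by positivity
  refine (norm_add_le _ _).trans ?_
  linarith

lemma osc_full (h h' : ℝ → ℂ) (β p q M τ : ℝ) (hpq : p ≤ q)
    (hd : ∀ u ∈ Set.Icc p q, HasDerivAt h (h' u) u) (hcont : ContinuousOn h' (Set.Icc p q))
    (hM : 0 ≤ M) (b1 : ∀ u ∈ Set.Icc p q, u ≠ β → ‖h u‖ ≤ M * |u - β| ^ (-(2/3) : ℝ))
    (b2 : ∀ u ∈ Set.Icc p q, u ≠ β → ‖h' u‖ ≤ M * |u - β| ^ (-(5/3) : ℝ)) (hτ : τ ≠ 0) :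
    ‖∫ u in p..q, Complex.exp (I * (τ * u : ℝ)) * h u‖ ≤ 14 * M * |τ| ^ (-(1/3) : ℝ) := by
  set c := max p (min q β) with hc
  have hpc : p ≤ c := le_max_left _ _
  have hcq : c ≤ q := max_le hpq (min_le_left _ _)
  have hco : ContinuousOn h (Set.Icc p q) := fun u hu => (hd u hu).continuousAt.continuousWithinAt
  have hcoe : ContinuousOn (fun u : ℝ => Complex.exp (I * (τ * u : ℝ)) * h u) (Set.Icc p q) :=
    (Continuous.continuousOn (by fun_prop)).mul hco
  have i1 : IntervalIntegrable (fun u : ℝ => Complex.exp (I * (τ * u : ℝ)) * h u) volume p c := by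
    apply ContinuousOn.intervalIntegrable
    rw [Set.uIcc_of_le hpc]; exact hcoe.mono (Set.Icc_subset_Icc_right hcq)
  have i2 : IntervalIntegrable (fun u : ℝ => Complex.exp (I * (τ * u : ℝ)) * h u) volume c q := by
    apply ContinuousOn.intervalIntegrable
    rw [Set.uIcc_of_le hcq]; exact hcoe.mono (Set.Icc_subset_Icc_left hpc)
  rw [← intervalIntegral.integral_add_adjacent_intervals i1 i2]
  have R : 0 ≤ 7 * M * |τ| ^ (-(1/3) : ℝ) := by positivity
  have ene : ∀ r : ℝ, ‖Complex.exp (I * (r : ℝ))‖ = 1 := fun r => by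
    rw [mul_comm]; exact Complex.norm_exp_ofReal_mul_I _
  have right : ‖∫ u in c..q, Complex.exp (I * (τ * u : ℝ)) * h u‖ ≤
      7 * M * |τ| ^ (-(1/3) : ℝ) := by
    by_cases hβ : β ≤ c
    · have hs : ∫ u in c..q, Complex.exp (I * (τ * u : ℝ)) * h u =
          Complex.exp (I * (τ * β : ℝ)) *
          ∫ u in (c - β)..(q - β), Complex.exp (I * (τ * u : ℝ)) * h (u + β) := by
        rw [← intervalIntegral.integral_const_mul,
          ← intervalIntegral.integral_comp_sub_right _ β]
        congr 1; ext u
        rw [← mul_assoc, ← Complex.exp_add]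
        congr 2
        · push_cast; ring
        · ring
      rw [hs, norm_mul, ene, one_mul]
      have hmem : ∀ u ∈ Set.Icc (c - β) (q - β), u + β ∈ Set.Icc p q := fun u hu =>
        ⟨by linarith [hu.1], by linarith [hu.2]⟩
      apply osc_half (fun u => h (u + β)) (fun u => h' (u + β)) _ _ M τ (by linarith) (by linarith)
      · intro u hu
        exact (hd (u + β) (hmem u hu)).comp_add_const u β
      · exact hcont.comp (by fun_prop) hmem
      · exact hM
      · intro u hu hu0
        have := b1 (u + β) (hmem u hu) (by linarith [hu0] : _ < _).ne'
        rwa [add_sub_cancel_right, abs_of_pos hu0] at this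
      · intro u hu hu0
        have := b2 (u + β) (hmem u hu) (by linarith [hu0] : _ < _).ne'
        rwa [add_sub_cancel_right, abs_of_pos hu0] at this
      · exact hτ
    · have : c = q := by
        rcases le_total q β with h1 | h1
        · rw [hc, min_eq_left h1, max_eq_right hpq]
        · exfalso; apply hβ; rw [hc, min_eq_right h1]; exact le_max_right _ _
      rw [this]; simpa using R
  have left : ‖∫ u in p..c, Complex.exp (I * (τ * u : ℝ)) * h u‖ ≤
      7 * M * |τ| ^ (-(1/3) : ℝ) := by
    by_cases hβ : c ≤ β
    · have hs : ∫ u in p..c, Complex.exp (I * (τ * u : ℝ)) * h u =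
          Complex.exp (I * (τ * β : ℝ)) *
          ∫ u in (β - c)..(β - p), Complex.exp (I * ((-τ) * u : ℝ)) * h (β - u) := by
        rw [← intervalIntegral.integral_const_mul,
          ← intervalIntegral.integral_comp_sub_left _ β]
        congr 1; ext u
        rw [← mul_assoc, ← Complex.exp_add]
        congr 2
        · push_cast; ring
        · ring
      rw [hs, norm_mul, ene, one_mul, ← abs_neg]
      have hmem : ∀ u ∈ Set.Icc (β - c) (β - p), β - u ∈ Set.Icc p q := fun u hu =>
        ⟨by linarith [hu.2], by linarith [hu.1]⟩
      apply osc_half (fun u => h (β - u)) (fun u => -h' (β - u)) _ _ M (-τ)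
        (by linarith) (by linarith)
      · intro u hu
        exact (hd (β - u) (hmem u hu)).comp_const_sub β u
      · exact (hcont.comp (by fun_prop) hmem).neg
      · exact hM
      · intro u hu hu0
        have := b1 (β - u) (hmem u hu) (by linarith [hu0] : _ < _).ne
        rwa [show β - u - β = -u by ring, abs_neg, abs_of_pos hu0] at this
      · intro u hu hu0
        have := b2 (β - u) (hmem u hu) (by linarith [hu0] : _ < _).ne
        rw [norm_neg]
        rwa [show β - u - β = -u by ring, abs_neg, abs_of_pos hu0] at this
      · exact neg_ne_zero.2 hτ
    · have : c = p := by
        rw [hc]; apply max_eq_left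
        by_contra! h1
        apply hβ
        rw [hc, max_eq_right h1.le]; exact min_le_right _ _
      rw [this]; simpa using R
  refine (norm_add_le _ _).trans ?_
  linarith

lemma geo_ne {q z : ℂ} (hq : ‖q‖ < 1) (hz : ‖z‖ ≤ 1) : 1 - q * z ≠ 0 := by
  intro h
  have h1 : q * z = 1 := (sub_eq_zero.mp h).symm
  have h2 : ‖q * z‖ = 1 := by rw [h1]; simp
  rw [norm_mul] at h2
  nlinarith [norm_nonneg q, norm_nonneg z]

lemma geo_int (q : ℂ) (hq : ‖q‖ < 1) :
    ∫ θ in (-Real.pi)..Real.pi, (1 - q * cexp (I * θ))⁻¹ = 2 * Real.pi := by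
  have hd : DiffContOnCl ℂ (fun z : ℂ => (1 - q * z)⁻¹) (Metric.ball 0 |1|) := by
    apply DifferentiableOn.diffContOnCl
    intro z hz
    have hz1 : ‖z‖ ≤ 1 := by
      have := Metric.closure_ball_subset_closedBall hz
      simpa using this
    apply DifferentiableAt.differentiableWithinAt
    have hne := geo_ne hq hz1
    fun_prop (disch := exact hne)
  have h1 := hd.circleAverage
  rw [Real.circleAverage_def] at h1
  have hper : Function.Periodic (fun θ : ℝ => (1 - q * cexp (I * θ))⁻¹) (2 * Real.pi) := by
    intro θ
    simp only
    congr 3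
    push_cast
    rw [mul_add, Complex.exp_add]
    have : cexp (I * (2 * (Real.pi : ℂ))) = 1 := by
      rw [mul_comm]; exact Complex.exp_two_pi_mul_I
    rw [this, mul_one]
  have h2 := hper.intervalIntegral_add_eq (-Real.pi) 0
  rw [show -Real.pi + 2 * Real.pi = Real.pi by ring, zero_add] at h2
  rw [h2]
  have h3 : ∀ θ : ℝ, (fun z : ℂ => (1 - q * z)⁻¹) (circleMap 0 1 θ) = (1 - q * cexp (I * θ))⁻¹ := by
    intro θ; simp [circleMap, mul_comm]
  simp only [h3] at h1
  have hpi : (2 * Real.pi) ≠ 0 := by positivity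
  rw [inv_smul_eq_iff₀ hpi] at h1
  rw [h1]; simp

lemma geo_int' (q : ℂ) (hq : ‖q‖ < 1) :
    ∫ θ in (-Real.pi)..Real.pi, (1 - q * cexp (-(I * θ)))⁻¹ = 2 * Real.pi := by
  rw [← geo_int q hq]
  have := intervalIntegral.integral_comp_neg (a := -Real.pi) (b := Real.pi)
    (f := fun θ : ℝ => (1 - q * cexp (I * θ))⁻¹)
  simp only [neg_neg] at this
  rw [← this]
  congr 1; funext θ; simp

lemma geo_alg {K S u v : ℂ} (hS0 : S ≠ 0) (hK : K ≠ 0) (hu : 1 - u ≠ 0) (hv : 1 - v ≠ 0)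
    (hS : S = K * (1 - u * v)) :
    (K * ((1 - u) * (1 - v)))⁻¹ = S⁻¹ * ((1 - u)⁻¹ + (1 - v)⁻¹ - 1) := by
  have h1 : 1 - u * v ≠ 0 := by
    intro h; rw [h, mul_zero] at hS; exact hS0 hS
  rw [hS]
  field_simp
  ring

lemma theta_int (A S : ℂ) (a b : ℝ) (hA : 0 < A.re) (hS : 0 < S.re)
    (hSA : S ^ 2 = A ^ 2 + ((a ^ 2 + b ^ 2 : ℝ) : ℂ)) :
    ∫ θ in (-Real.pi)..Real.pi, (A - I * ((a * Real.cos θ + b * Real.sin θ : ℝ) : ℂ))⁻¹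
      = 2 * Real.pi / S := by
  have hAS : A + S ≠ 0 := by
    intro h
    have := congrArg Complex.re h
    simp at this; linarith
  have hS0 : S ≠ 0 := by
    rintro rfl; simp at hS
  -- |A - S| < |A + S|
  have him : S.re * S.im = A.re * A.im := by
    have := congrArg Complex.im hSA
    simp [pow_two] at this
    nlinarith
  have him2 : 0 ≤ A.im * S.im := by
    have h1 : S.im = A.re * A.im / S.re := by field_simp; linarith
    rw [h1]
    have : A.im * (A.re * A.im / S.re) = A.im ^ 2 * A.re / S.re := by ring
    rw [this]; positivity
  have hlt : ‖A - S‖ < ‖A + S‖ := by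
    rw [← sq_lt_sq₀ (norm_nonneg _) (norm_nonneg _), ← Complex.normSq_eq_norm_sq,
      ← Complex.normSq_eq_norm_sq, Complex.normSq_apply, Complex.normSq_apply]
    simp
    nlinarith [mul_pos hA hS]
  set q1 : ℂ := I * (a - I * b) / (A + S) with hq1
  set q2 : ℂ := I * (a + I * b) / (A + S) with hq2
  have hab : (S - A) * (S + A) = (a ^ 2 + b ^ 2 : ℂ) := by
    push_cast at hSA; linear_combination hSA
  have hprod : q1 * q2 = (A - S) / (A + S) := by
    rw [hq1, hq2]
    field_simp
    linear_combination (a^2 - I^2*b^2 : ℂ) * (I_sq) + hab * (1) + (b^2 : ℂ) * I_sq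
  have hnn : ‖q1‖ = ‖q2‖ := by
    rw [hq1, hq2, norm_div, norm_div, norm_mul, norm_mul]
    congr 2
    rw [← Complex.norm_conj (a + I * b)]
    congr 1
    simp [sub_eq_add_neg]
  have hlt1 : ‖q1‖ * ‖q1‖ < 1 := by
    nth_rewrite 2 [hnn]
    rw [← norm_mul, hprod, norm_div, div_lt_one (by positivity)]
    exact hlt
  have hq1' : ‖q1‖ < 1 := by nlinarith [norm_nonneg q1]
  have hq2' : ‖q2‖ < 1 := hnn ▸ hq1'
  have hIntg : ∀ θ : ℝ, (A - I * ((a * Real.cos θ + b * Real.sin θ : ℝ) : ℂ))⁻¹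
      = S⁻¹ * ((1 - q1 * cexp (I * θ))⁻¹ + (1 - q2 * cexp (-(I * θ)))⁻¹ - 1) := by
    intro θ
    have n1 : 1 - q1 * cexp (I * θ) ≠ 0 := geo_ne hq1' (by rw [mul_comm, Complex.norm_exp_ofReal_mul_I])
    have n2 : 1 - q2 * cexp (-(I * θ)) ≠ 0 := geo_ne hq2' (by
      rw [show -(I * (θ:ℂ)) = ((-θ : ℝ) : ℂ) * I by push_cast; ring, Complex.norm_exp_ofReal_mul_I])
    have hz : cexp (I * θ) * cexp (-(I * θ)) = 1 := by rw [← Complex.exp_add]; simp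
    have hfac : A - I * ((a * Real.cos θ + b * Real.sin θ : ℝ) : ℂ)
        = ((A + S) / 2) * ((1 - q1 * cexp (I * θ)) * (1 - q2 * cexp (-(I * θ)))) := by
      have e1 : cexp (I * θ) = Complex.cos θ + Complex.sin θ * I := by
        rw [mul_comm, Complex.exp_mul_I]
      have e2 : cexp (-(I * θ)) = Complex.cos θ - Complex.sin θ * I := by
        rw [show -(I * (θ:ℂ)) = (-θ) * I by ring, Complex.exp_mul_I, Complex.cos_neg, Complex.sin_neg]
        ring
      have e3 : (1 - q1 * cexp (I * θ)) * (1 - q2 * cexp (-(I * θ)))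
        = 1 - q1 * cexp (I * θ) - q2 * cexp (-(I * θ)) + q1 * q2 * (cexp (I * θ) * cexp (-(I * θ))) := by
        ring
      rw [e3, hz, hprod, e1, e2, hq1, hq2]
      push_cast
      field_simp
      linear_combination (-2 * (b : ℂ) * I * Complex.sin θ) * I_sq
    have hS2 : S = ((A + S) / 2) * (1 - q1 * q2) := by
      rw [hprod]; field_simp; ring
    rw [hfac]
    have hn : (A + S) / 2 ≠ 0 := div_ne_zero hAS two_ne_zero
    have hS3 : S = ((A + S) / 2) * (1 - q1 * cexp (I * θ) * (q2 * cexp (-(I * θ)))) := by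
      rw [show q1 * cexp (I * θ) * (q2 * cexp (-(I * θ)))
        = q1 * q2 * (cexp (I * θ) * cexp (-(I * θ))) by ring, hz, mul_one]
      exact hS2
    exact geo_alg hS0 hn n1 n2 hS3
  simp only [hIntg]
  have c1 : Continuous fun θ : ℝ => (1 - q1 * cexp (I * θ))⁻¹ := by
    apply Continuous.inv₀ (by fun_prop)
    intro θ
    exact geo_ne hq1' (by rw [mul_comm, Complex.norm_exp_ofReal_mul_I])
  have c2 : Continuous fun θ : ℝ => (1 - q2 * cexp (-(I * θ)))⁻¹ := by
    apply Continuous.inv₀ (by fun_prop)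
    intro θ
    exact geo_ne hq2' (by
      rw [show -(I * (θ:ℂ)) = ((-θ : ℝ) : ℂ) * I by push_cast; ring, Complex.norm_exp_ofReal_mul_I])
  have c12 : Continuous fun θ : ℝ => (1 - q1 * cexp (I * θ))⁻¹ + (1 - q2 * cexp (-(I * θ)))⁻¹ := c1.add c2
  rw [intervalIntegral.integral_const_mul, intervalIntegral.integral_sub
    (c12.intervalIntegrable _ _) (continuous_const.intervalIntegrable _ _),
    intervalIntegral.integral_add (c1.intervalIntegrable _ _) (c2.intervalIntegrable _ _),
    geo_int _ hq1', geo_int' _ hq2']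
  simp
  field_simp
  ring

/-- spherical coordinates -/
def sph (p : ℝ × (ℝ × ℝ)) : EuclideanSpace ℝ (Fin 3) :=
  !₂[p.1 * Real.cos p.2.1 * Real.cos p.2.2, p.1 * Real.cos p.2.1 * Real.sin p.2.2,
    p.1 * Real.sin p.2.1]

lemma continuous_sph : Continuous sph := by
  unfold sph; fun_prop

/-- base measure for spherical coordinates -/
def sphBase : Measure (ℝ × (ℝ × ℝ)) :=
  (volume.restrict (Set.Ioi 0)).prod ((volume.restrict (Set.Ioo (-Real.pi) Real.pi)).prod
    (volume.restrict (Set.Ioo (-Real.pi) Real.pi)))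

/-- density for spherical coordinates -/
def sphDen (p : ℝ × (ℝ × ℝ)) : ℝ≥0∞ :=
  ENNReal.ofReal p.1 * ENNReal.ofReal (p.1 * Real.cos p.2.1)

lemma measurable_sphDen : Measurable sphDen := by
  unfold sphDen; fun_prop

lemma lintegral_polar (g : ℝ × ℝ → ℝ≥0∞) (hg : Measurable g) :
    ∫⁻ p, g p = ∫⁻ r in Set.Ioi (0:ℝ), ∫⁻ θ in Set.Ioo (-Real.pi) Real.pi,
      ENNReal.ofReal r * g (r * Real.cos θ, r * Real.sin θ) := by
  rw [← lintegral_comp_polarCoord_symm, polarCoord_target, Measure.volume_eq_prod,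
    ← Measure.prod_restrict, lintegral_prod]
  · simp [polarCoord_symm_apply]
  · simp only [polarCoord_symm_apply, smul_eq_mul]
    apply Measurable.aemeasurable
    fun_prop

lemma lintegral_sph (G : EuclideanSpace ℝ (Fin 3) → ℝ≥0∞) (hG : Measurable G) :
    ∫⁻ x, G x = ∫⁻ p, sphDen p * G (sph p) ∂sphBase := by
  have hc : Continuous fun p : ℝ × (ℝ × ℝ) => (!₂[p.2.1, p.2.2, p.1] : EuclideanSpace ℝ (Fin 3)) := by
    fun_prop
  set g : ℝ × (ℝ × ℝ) → ℝ≥0∞ := fun p => G !₂[p.2.1, p.2.2, p.1] with hg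
  have mg : Measurable g := hG.comp hc.measurable
  have h1 : ∫⁻ x, G x = ∫⁻ p, g p := by
    rw [← eucEquiv_mp.lintegral_comp_emb eucEquiv.measurableEmbedding]
    apply lintegral_congr; intro x
    rw [hg]; simp only
    rw [← eucEquiv_symm_apply, MeasurableEquiv.symm_apply_apply]
  rw [h1, Measure.volume_eq_prod, lintegral_prod _ mg.aemeasurable]
  have h2 : ∀ z : ℝ, ∫⁻ w : ℝ × ℝ, g (z, w) = ∫⁻ r in Set.Ioi (0:ℝ),
      ∫⁻ θ in Set.Ioo (-Real.pi) Real.pi, ENNReal.ofReal r * g (z, (r * Real.cos θ, r * Real.sin θ)) :=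
    fun z => lintegral_polar (fun w => g (z, w)) (by fun_prop)
  simp only [h2]
  have h3 : ∀ z : ℝ, (∫⁻ r in Set.Ioi (0:ℝ),
      ∫⁻ θ in Set.Ioo (-Real.pi) Real.pi, ENNReal.ofReal r * g (z, (r * Real.cos θ, r * Real.sin θ)))
      = ∫⁻ r : ℝ, ENNReal.ofReal r *
        ∫⁻ θ in Set.Ioo (-Real.pi) Real.pi, g (z, (r * Real.cos θ, r * Real.sin θ)) := by
    intro z
    rw [← lintegral_indicator measurableSet_Ioi]
    apply lintegral_congr; intro r
    by_cases hr : 0 < r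
    · rw [Set.indicator_of_mem (by exact hr), lintegral_const_mul _ (by fun_prop)]
    · rw [Set.indicator_of_notMem (by exact hr), ENNReal.ofReal_of_nonpos (not_lt.mp hr), zero_mul]
  simp only [h3]
  set k : ℝ × ℝ → ℝ≥0∞ := fun w => ENNReal.ofReal w.1 *
        ∫⁻ θ in Set.Ioo (-Real.pi) Real.pi, g (w.2, (w.1 * Real.cos θ, w.1 * Real.sin θ)) with hk
  have mk : Measurable k := by
    apply Measurable.mul (by fun_prop)
    apply Measurable.lintegral_prod_right' (f := fun q : (ℝ × ℝ) × ℝ =>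
      g (q.1.2, (q.1.1 * Real.cos q.2, q.1.1 * Real.sin q.2)))
    fun_prop
  have h4 : ∫⁻ z : ℝ, ∫⁻ r : ℝ, ENNReal.ofReal r *
        ∫⁻ θ in Set.Ioo (-Real.pi) Real.pi, g (z, (r * Real.cos θ, r * Real.sin θ)) = ∫⁻ w, k w := by
    rw [Measure.volume_eq_prod, lintegral_prod_symm _ mk.aemeasurable]
  rw [h4, lintegral_polar k mk]
  have msph : Measurable fun p => sphDen p * G (sph p) :=
    measurable_sphDen.mul (hG.comp continuous_sph.measurable)
  rw [sphBase, lintegral_prod _ msph.aemeasurable]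
  apply lintegral_congr; intro r
  rw [lintegral_prod]
  · apply lintegral_congr; intro α
    rw [hk]; simp only
    rw [← mul_assoc, ← lintegral_const_mul _ (by fun_prop)]
    rfl
  · exact (msph.comp measurable_prodMk_left).aemeasurable

lemma map_sph : (volume : Measure (EuclideanSpace ℝ (Fin 3))) = (sphBase.withDensity sphDen).map sph := by
  ext s hs
  have := lintegral_sph (s.indicator 1) (measurable_one.indicator hs)
  rw [lintegral_indicator_one hs] at this
  rw [this, Measure.map_apply continuous_sph.measurable hs,
    withDensity_apply _ (continuous_sph.measurable hs), ← lintegral_indicator (continuous_sph.measurable hs)]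
  apply lintegral_congr; intro p
  by_cases h : sph p ∈ s <;> simp [h, Set.indicator]

lemma integral_sph (G : EuclideanSpace ℝ (Fin 3) → ℂ) (hG : Measurable G) :
    ∫ x, G x = ∫ p, (sphDen p).toReal • G (sph p) ∂sphBase := by
  rw [map_sph, integral_map continuous_sph.measurable.aemeasurable hG.aestronglyMeasurable,
    integral_withDensity_eq_integral_toReal_smul measurable_sphDen]
  filter_upwards with p
  exact ENNReal.mul_lt_top ENNReal.ofReal_lt_top ENNReal.ofReal_lt_top

lemma norm_sph (r α θ : ℝ) (hr : 0 < r) : ‖sph (r, (α, θ))‖ = r := by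
  rw [EuclideanSpace.norm_eq, Real.sqrt_eq_iff_mul_self_eq (by positivity) hr.le]
  simp [sph, Fin.sum_univ_three]
  have h1 := Real.sin_sq_add_cos_sq α
  have h2 := Real.sin_sq_add_cos_sq θ
  linear_combination (r^2) * h1 + (r * Real.cos α)^2 * h2

lemma pRot_sph (r α θ : ℝ) (hr : 0 < r) : pRot (sph (r, (α, θ))) = Real.sin α := by
  rw [pRot, norm_sph r α θ hr]
  simp [sph]; field_simp

lemma inner_sph (r α θ : ℝ) (x : EuclideanSpace ℝ (Fin 3)) : ⟪x, sph (r, (α, θ))⟫ =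
    r * (x 2 * Real.sin α + Real.cos α * (x 0 * Real.cos θ + x 1 * Real.sin θ)) := by
  simp [sph, PiLp.inner_apply, Fin.sum_univ_three]
  ring

/-- integrand of the regularised kernel -/
def kerD (δ τ : ℝ) (x ξ : EuclideanSpace ℝ (Fin 3)) : ℂ :=
  cexp (I * ofReal (⟪x, ξ⟫ + τ * pRot ξ)) * ((‖ξ‖ ^ 2)⁻¹ * Real.exp (-δ * ‖ξ‖) : ℝ)

lemma measurable_pRot : Measurable pRot := by
  unfold pRot; fun_prop

lemma measurable_kerD (δ τ : ℝ) (x : EuclideanSpace ℝ (Fin 3)) : Measurable (kerD δ τ x) := by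
  have := measurable_pRot
  unfold kerD; fun_prop

/-- the discriminant -/
def Dfun (δ b z : ℝ) (u : ℝ) : ℂ := (δ - I * (z * u)) ^ 2 + (b * (1 - u ^ 2) : ℝ)

lemma Dfun_re (δ b z u : ℝ) : (Dfun δ b z u).re = δ ^ 2 - z ^ 2 * u ^ 2 + b * (1 - u ^ 2) := by
  simp [Dfun, pow_two]
  ring

lemma Dfun_im (δ b z u : ℝ) : (Dfun δ b z u).im = - 2 * δ * z * u := by
  simp [Dfun, pow_two]
  ring

lemma Dfun_slit (δ b z u : ℝ) (hδ : 0 < δ) (hb : 0 ≤ b) (hz : z ≠ 0) :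
    Dfun δ b z u ∈ slitPlane := by
  rw [Complex.mem_slitPlane_iff, Dfun_re, Dfun_im]
  by_cases hu : u = 0
  · left; subst hu; simp; positivity
  · right; simp; exact ⟨⟨hδ.ne', hz⟩, hu⟩

lemma continuous_Dfun (δ b z : ℝ) : Continuous (Dfun δ b z) := by
  unfold Dfun; fun_prop

lemma re_sqrt_pos {w : ℂ} (hw : w ∈ slitPlane) : 0 < (w ^ (1/2 : ℂ)).re := by
  rw [Complex.cpow_def_of_ne_zero (Complex.slitPlane_ne_zero hw), Complex.exp_re]
  apply mul_pos (Real.exp_pos _)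
  have him : (Complex.log w * (1/2 : ℂ)).im = w.arg / 2 := by
    rw [show (1/2 : ℂ) = ((1/2 : ℝ) : ℂ) by push_cast; rfl, Complex.im_mul_ofReal, Complex.log_im]
    ring
  rw [him]
  have h1 := Complex.neg_pi_lt_arg w
  have h2 := lt_of_le_of_ne (Complex.arg_le_pi w) (Complex.mem_slitPlane_iff_arg.mp hw).1
  apply Real.cos_pos_of_mem_Ioo
  constructor <;> linarith

/-- integrand in spherical coordinates -/
def sphF (δ τ : ℝ) (x : EuclideanSpace ℝ (Fin 3)) (p : ℝ × (ℝ × ℝ)) : ℂ :=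
  ((max (Real.cos p.2.1) 0 : ℝ) : ℂ) * cexp (I * (τ * Real.sin p.2.1 : ℝ)) *
    cexp (-((δ - I * (x 2 * Real.sin p.2.1) : ℂ) - I * ((Real.cos p.2.1 * x 0 * Real.cos p.2.2 +
      Real.cos p.2.1 * x 1 * Real.sin p.2.2 : ℝ) : ℂ)) * p.1)

lemma continuous_sphF (δ τ : ℝ) (x : EuclideanSpace ℝ (Fin 3)) : Continuous (sphF δ τ x) := by
  unfold sphF; fun_prop

lemma norm_sphF_le (δ τ : ℝ) (x : EuclideanSpace ℝ (Fin 3)) (p : ℝ × (ℝ × ℝ)) :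
    ‖sphF δ τ x p‖ ≤ Real.exp (-δ * p.1) := by
  rw [sphF, norm_mul, norm_mul, mul_comm I ((_ : ℝ) : ℂ), Complex.norm_exp_ofReal_mul_I, mul_one,
    Complex.norm_exp]
  have h1 : ‖((max (Real.cos p.2.1) 0 : ℝ) : ℂ)‖ ≤ 1 := by
    rw [Complex.norm_real, Real.norm_of_nonneg (le_max_right _ _)]
    exact max_le (Real.cos_le_one _) zero_le_one
  refine (mul_le_of_le_one_left (Real.exp_pos _).le h1).trans (le_of_eq ?_)
  congr 1
  simp [-ofReal_cos, -ofReal_sin]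

instance : SFinite sphBase := by unfold sphBase; infer_instance

lemma integrable_sphF (δ τ : ℝ) (hδ : 0 < δ) (x : EuclideanSpace ℝ (Fin 3)) :
    Integrable (sphF δ τ x) sphBase := by
  have h1 : Integrable (fun r : ℝ => Real.exp (-δ * r)) (volume.restrict (Set.Ioi 0)) :=
    integrableOn_exp_mul_Ioi (by linarith) 0
  have h2 : Integrable (fun p : ℝ × (ℝ × ℝ) => Real.exp (-δ * p.1)) sphBase := h1.comp_fst _
  exact h2.mono' (continuous_sphF δ τ x).aestronglyMeasurable
    (Filter.Eventually.of_forall (norm_sphF_le δ τ x))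

lemma sphBase_pos : ∀ᵐ p ∂sphBase, 0 < p.1 := by
  have : ∀ᵐ r ∂(volume.restrict (Set.Ioi (0:ℝ))), 0 < r := ae_restrict_mem measurableSet_Ioi
  exact Measure.quasiMeasurePreserving_fst.ae this

lemma sphDen_kerD (δ τ : ℝ) (x : EuclideanSpace ℝ (Fin 3)) (p : ℝ × (ℝ × ℝ)) (hp : 0 < p.1) :
    (sphDen p).toReal • kerD δ τ x (sph p) = sphF δ τ x p := by
  obtain ⟨r, α, θ⟩ := p
  simp only at hp
  have h0 : (sphDen (r, (α, θ))).toReal = r * (r * max (Real.cos α) 0) := by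
    simp only [sphDen]
    rw [ENNReal.toReal_mul, ENNReal.toReal_ofReal hp.le, ENNReal.toReal_ofReal']
    congr 1
    rw [mul_max_of_nonneg _ _ hp.le, mul_zero]
  rw [h0, kerD, norm_sph r α θ hp, pRot_sph r α θ hp, inner_sph, sphF]
  simp only [Complex.real_smul]
  have e : cexp (I * ((r * (x 2 * Real.sin α + Real.cos α * (x 0 * Real.cos θ + x 1 * Real.sin θ))
      + τ * Real.sin α : ℝ) : ℂ)) * (Real.exp (-δ * r) : ℝ) = cexp (I * (τ * Real.sin α : ℝ)) *
    cexp (-((δ - I * (x 2 * Real.sin α) : ℂ) - I * ((Real.cos α * x 0 * Real.cos θ +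
      Real.cos α * x 1 * Real.sin θ : ℝ) : ℂ)) * r) := by
    rw [Complex.ofReal_exp, ← Complex.exp_add, ← Complex.exp_add]
    congr 1
    push_cast; ring
  have hr : (r : ℂ) ≠ 0 := by exact_mod_cast hp.ne'
  rw [mul_assoc ((max (Real.cos α) 0 : ℝ) : ℂ), ← e]
  push_cast
  field_simp

lemma integrable_kerD (δ τ : ℝ) (hδ : 0 < δ) (x : EuclideanSpace ℝ (Fin 3)) :
    Integrable (kerD δ τ x) := by
  rw [map_sph, integrable_map_measure (measurable_kerD δ τ x).aestronglyMeasurable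
    continuous_sph.measurable.aemeasurable, integrable_withDensity_iff_integrable_smul' measurable_sphDen]
  · refine (integrable_sphF δ τ hδ x).congr ?_
    filter_upwards [sphBase_pos] with p hp
    exact (sphDen_kerD δ τ x p hp).symm
  · filter_upwards with p
    exact ENNReal.mul_lt_top ENNReal.ofReal_lt_top ENNReal.ofReal_lt_top

lemma Kd_eq1 (δ τ : ℝ) (hδ : 0 < δ) (x : EuclideanSpace ℝ (Fin 3)) (hz : x 2 ≠ 0) :
    ∫ ξ, kerD δ τ x ξ = ∫ α in Set.Ioo (-Real.pi) Real.pi,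
      ((max (Real.cos α) 0 : ℝ) : ℂ) * (cexp (I * (τ * Real.sin α : ℝ)) *
      (2 * Real.pi * (Dfun δ (x 0 ^ 2 + x 1 ^ 2) (x 2) (Real.sin α)) ^ (-(1/2) : ℂ))) := by
  have hi := integrable_sphF δ τ hδ x
  rw [integral_sph _ (measurable_kerD δ τ x)]
  have h1 : ∫ p, (sphDen p).toReal • kerD δ τ x (sph p) ∂sphBase = ∫ p, sphF δ τ x p ∂sphBase := by
    apply integral_congr_ae
    filter_upwards [sphBase_pos] with p hp
    exact sphDen_kerD δ τ x p hp
  rw [h1]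
  unfold sphBase at hi ⊢
  rw [integral_prod_symm _ hi]
  have hi2 := hi.integral_prod_right
  rw [integral_prod _ hi2]
  apply integral_congr_ae
  filter_upwards with α
  set A : ℂ := δ - I * (x 2 * Real.sin α) with hA
  have hAre : A.re = δ := by simp [hA, -ofReal_sin]
  have h2 : ∀ θ : ℝ, ∫ r in Set.Ioi (0:ℝ), sphF δ τ x (r, (α, θ)) =
      ((max (Real.cos α) 0 : ℝ) : ℂ) * cexp (I * (τ * Real.sin α : ℝ)) *
      (A - I * ((Real.cos α * x 0 * Real.cos θ + Real.cos α * x 1 * Real.sin θ : ℝ) : ℂ))⁻¹ := by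
    intro θ
    simp only [sphF]
    rw [integral_const_mul]
    congr 1
    rw [← hA]
    rw [integral_exp_mul_complex_Ioi]
    · simp only [ofReal_zero, mul_zero, Complex.exp_zero]
      rw [neg_div_neg_eq, one_div]
    · simp [hAre, -ofReal_sin, -ofReal_cos, hδ]
  simp only [h2]
  rw [integral_const_mul, mul_assoc]
  congr 2
  rw [← integral_Ioc_eq_integral_Ioo, ← intervalIntegral.integral_of_le (by linarith [Real.pi_pos])]
  have hslit := Dfun_slit δ (x 0 ^ 2 + x 1 ^ 2) (x 2) (Real.sin α) hδ (by positivity) hz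
  have := theta_int A ((Dfun δ (x 0 ^ 2 + x 1 ^ 2) (x 2) (Real.sin α)) ^ (1/2 : ℂ))
    (Real.cos α * x 0) (Real.cos α * x 1) (by rw [hAre]; exact hδ) (re_sqrt_pos hslit) (by
      rw [← Complex.cpow_nat_mul]
      norm_num [Dfun, ← hA]
      have := Complex.sin_sq_add_cos_sq α
      rw [hA, ofReal_sin]
      linear_combination (-(x 0 ^ 2 + x 1 ^ 2) : ℂ) * this)
  rw [this, Complex.cpow_neg]
  rfl

lemma Kd_eq (δ τ : ℝ) (hδ : 0 < δ) (x : EuclideanSpace ℝ (Fin 3)) (hz : x 2 ≠ 0) :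
    ∫ ξ, kerD δ τ x ξ = 2 * Real.pi * ∫ u in (-1:ℝ)..1, cexp (I * (τ * u : ℝ)) *
      (Dfun δ (x 0 ^ 2 + x 1 ^ 2) (x 2) u) ^ (-(1/2) : ℂ) := by
  rw [Kd_eq1 δ τ hδ x hz]
  set H : ℝ → ℂ := fun u => cexp (I * (τ * u : ℝ)) *
      (2 * Real.pi * (Dfun δ (x 0 ^ 2 + x 1 ^ 2) (x 2) u) ^ (-(1/2) : ℂ)) with hH
  have hHc : Continuous H := by
    apply Continuous.mul (by fun_prop)
    apply Continuous.mul (by fun_prop)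
    exact (continuous_Dfun _ _ _).cpow continuous_const
      (fun u => Dfun_slit _ _ _ _ hδ (by positivity) hz)
  have h1 : ∫ α in Set.Ioo (-Real.pi) Real.pi, ((max (Real.cos α) 0 : ℝ) : ℂ) * H (Real.sin α)
      = ∫ α in Set.Ioc (-(Real.pi/2)) (Real.pi/2), Real.cos α • H (Real.sin α) := by
    rw [← integral_indicator measurableSet_Ioo, ← integral_indicator measurableSet_Ioc]
    congr 1; ext α
    have hpi := Real.pi_pos
    by_cases h : α ∈ Set.Ioc (-(Real.pi/2)) (Real.pi/2)
    · have hc : 0 ≤ Real.cos α := Real.cos_nonneg_of_mem_Icc ⟨h.1.le, h.2⟩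
      rw [Set.indicator_of_mem h, Set.indicator_of_mem (show α ∈ Set.Ioo (-Real.pi) Real.pi from
        ⟨by linarith [h.1], by linarith [h.2]⟩),
        max_eq_left hc]
      simp
    · rw [Set.indicator_of_notMem h]
      by_cases h' : α ∈ Set.Ioo (-Real.pi) Real.pi
      · rw [Set.indicator_of_mem h']
        have hc : Real.cos α ≤ 0 := by
          by_cases h3 : α ≤ Real.pi / 2
          · have h4 : α ≤ -(Real.pi/2) := by
              by_contra h5; exact h ⟨not_le.mp h5, h3⟩
            rw [← Real.cos_neg]
            exact Real.cos_nonpos_of_pi_div_two_le_of_le (by linarith) (by linarith [h'.1])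
          · exact Real.cos_nonpos_of_pi_div_two_le_of_le (by linarith) (by linarith [h'.2])
        rw [max_eq_right hc]; simp
      · rw [Set.indicator_of_notMem h']
  rw [h1, ← intervalIntegral.integral_of_le (by linarith [Real.pi_pos])]
  have h2 := intervalIntegral.integral_deriv_smul_comp (a := -(Real.pi/2)) (b := Real.pi/2)
    (f := Real.sin) (f' := Real.cos) (g := H) (fun x _ => Real.hasDerivAt_sin x)
    Real.continuous_cos.continuousOn hHc
  simp only [Function.comp_apply, Real.sin_neg, Real.sin_pi_div_two] at h2
  rw [h2, ← intervalIntegral.integral_const_mul]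
  congr 1; ext u; rw [hH]; ring

lemma Dfun_normSq (δ b z u σ : ℝ) (hn : b + z ^ 2 ≠ 0)
    (hσ : (b + z ^ 2) ^ 2 * σ ^ 2 = b * (δ ^ 2 + (b + z ^ 2))) :
    ‖Dfun δ b z u‖ ^ 2 = (b + z ^ 2) ^ 2 * (((u - σ) ^ 2 + (δ * z / (b + z ^ 2)) ^ 2) *
      ((u + σ) ^ 2 + (δ * z / (b + z ^ 2)) ^ 2)) := by
  rw [← Complex.normSq_eq_norm_sq, Complex.normSq_apply, Dfun_re, Dfun_im]
  set n := b + z ^ 2 with hnd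
  have hb : b = n - z ^ 2 := by rw [hnd]; ring
  set γ := δ * z / n with hγ
  have h1 : n * γ = δ * z := by rw [hγ]; field_simp
  have h2 : n ^ 2 * (σ ^ 2 + γ ^ 2) = n * (δ ^ 2 + b) := by
    have : n ^ 2 * γ ^ 2 = δ ^ 2 * z ^ 2 := by rw [← mul_pow, h1, mul_pow]
    rw [mul_add, hσ, this, hb]; ring
  have h3 : n * (σ ^ 2 + γ ^ 2) = δ ^ 2 + b := by
    apply mul_left_cancel₀ hn; rw [← h2]; ring
  have e : n ^ 2 * (((u - σ) ^ 2 + γ ^ 2) * ((u + σ) ^ 2 + γ ^ 2)) =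
    (n * u ^ 2 + n * (σ ^ 2 + γ ^ 2)) ^ 2 - 4 * u ^ 2 * (n ^ 2 * σ ^ 2) := by ring
  rw [e, h3, hσ, hb]; ring

lemma Dfun_hasDerivAt (δ b z u : ℝ) :
    HasDerivAt (Dfun δ b z) (-2 * ((b + z ^ 2) * u + I * (δ * z))) u := by
  have h1 : HasDerivAt (fun u : ℝ => (u : ℂ)) 1 u := Complex.ofRealCLM.hasDerivAt
  have h2 : HasDerivAt (fun u : ℝ => ((δ : ℂ) - I * (z * u)) ^ 2 + (b : ℂ) * (1 - (u : ℂ) ^ 2))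
    (2 * ((δ : ℂ) - I * (z * u)) * (-(I * z)) + (b : ℂ) * (-(2 * u))) u := by
    have := (((h1.const_mul (z : ℂ)).const_mul I).const_sub (δ : ℂ)).pow 2
    have h3 := ((h1.pow 2).const_sub (1 : ℂ)).const_mul (b : ℂ)
    refine (this.add h3).congr_deriv ?_
    simp
  have e : Dfun δ b z = fun u : ℝ => ((δ : ℂ) - I * (z * u)) ^ 2 + (b : ℂ) * (1 - (u : ℂ) ^ 2) := by
    funext u; simp [Dfun]
  rw [e]
  refine h2.congr_deriv ?_
  linear_combination (2 * z ^ 2 * u : ℂ) * I_sq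

set_option maxHeartbeats 1000000 in
/-- bounds for the amplitude -/
lemma amp_bounds (δ a b z u σ : ℝ) (hδ : 0 < δ) (ha : a ≠ 0) (hb : b ≠ 0) (hz : z ≠ 0)
    (hσ : ((a ^ 2 + b ^ 2) + z ^ 2) ^ 2 * σ ^ 2 = (a ^ 2 + b ^ 2) * (δ ^ 2 + ((a ^ 2 + b ^ 2) + z ^ 2)))
    (huσ : 0 ≤ u * σ) (hne : u ≠ σ) :
    ‖(Dfun δ (a ^ 2 + b ^ 2) z u) ^ (-(1/2) : ℂ)‖ ≤ |a * b * z| ^ (-(1/3) : ℝ) * |u - σ| ^ (-(2/3) : ℝ) ∧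
    ‖(-(1/2) : ℂ) * (Dfun δ (a ^ 2 + b ^ 2) z u) ^ (-(1/2) - 1 : ℂ) *
      (-2 * (((a ^ 2 + b ^ 2 : ℝ) + z ^ 2) * u + I * (δ * z)))‖
      ≤ |a * b * z| ^ (-(1/3) : ℝ) * |u - σ| ^ (-(5/3) : ℝ) := by
  set c := a ^ 2 + b ^ 2 with hc
  have hc0 : 0 < c := by positivity
  set n := c + z ^ 2 with hn
  have hn0 : 0 < n := by positivity
  have hD := Dfun_normSq δ c z u σ (by rw [← hn]; exact hn0.ne') hσ
  have hslit := Dfun_slit δ c z u hδ hc0.le hz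
  rw [← hn] at hD
  set D := Dfun δ c z u with hDd
  set γ := δ * z / n with hγ
  have hDpos : 0 < ‖D‖ := norm_pos_iff.mpr (Complex.slitPlane_ne_zero hslit)
  have hd : 0 < |u - σ| := abs_pos.mpr (sub_ne_zero.mpr hne)
  set d := |u - σ| with hdd
  have hd2 : d ^ 2 = (u - σ) ^ 2 := sq_abs _
  set P := |a * b * z| with hP
  have hP0 : 0 < P := by rw [hP]; positivity
  have hP2 : P ^ 2 = a ^ 2 * b ^ 2 * z ^ 2 := by rw [hP, sq_abs]; ring
  have hs1 : d ^ 2 ≤ (u + σ) ^ 2 := by rw [hd2]; linarith [show (u + σ) ^ 2 = (u - σ) ^ 2 + 4 * (u * σ) by ring]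
  have hs2 : σ ^ 2 ≤ (u + σ) ^ 2 := by linarith [sq_nonneg u, show (u + σ) ^ 2 = σ ^ 2 + u ^ 2 + 2 * (u * σ) by ring]
  have hs3 : u ^ 2 ≤ (u + σ) ^ 2 := by linarith [sq_nonneg σ, show (u + σ) ^ 2 = σ ^ 2 + u ^ 2 + 2 * (u * σ) by ring]
  -- lower bound
  have hσ2 : c ≤ n * σ ^ 2 := by
    have : n * c ≤ n * (n * σ ^ 2) := by
      rw [show n * (n * σ ^ 2) = n ^ 2 * σ ^ 2 by ring, hσ]
      have := mul_pos hc0 (pow_pos hδ 2)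
      linarith
    exact le_of_mul_le_mul_left this hn0
  have hlow2 : n ^ 2 * (d ^ 2 * (u + σ) ^ 2) ≤ ‖D‖ ^ 2 := by
    rw [hD, hd2]
    have e1 : (u - σ) ^ 2 ≤ (u - σ) ^ 2 + γ ^ 2 := le_add_of_nonneg_right (sq_nonneg γ)
    have e2 : (u + σ) ^ 2 ≤ (u + σ) ^ 2 + γ ^ 2 := le_add_of_nonneg_right (sq_nonneg γ)
    gcongr
  have hcube : P ^ 2 * d ^ 4 ≤ ‖D‖ ^ 3 := by
    have h6 : (P ^ 2 * d ^ 4) ^ 2 ≤ (‖D‖ ^ 3) ^ 2 := by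
      calc (P ^ 2 * d ^ 4) ^ 2 ≤ (n ^ 2 * c * d ^ 4) ^ 2 := by
            gcongr
            rw [hP2]
            have h1 : a ^ 2 ≤ n := by have := sq_nonneg b; have := sq_nonneg z; linarith
            have h2 : z ^ 2 ≤ n := by linarith
            have h3 : b ^ 2 ≤ c := by have := sq_nonneg a; linarith
            calc a ^ 2 * b ^ 2 * z ^ 2 ≤ n * c * n := by gcongr
              _ = n ^ 2 * c := by ring
        _ ≤ (n ^ 2 * (n * σ ^ 2) * d ^ 4) ^ 2 := by gcongr
        _ = n ^ 6 * (d ^ 6 * (d ^ 2 * (σ ^ 2 * σ ^ 2))) := by ring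
        _ ≤ n ^ 6 * (d ^ 6 * ((u + σ) ^ 2 * ((u + σ) ^ 2 * (u + σ) ^ 2))) := by gcongr
        _ = (n ^ 2 * (d ^ 2 * (u + σ) ^ 2)) ^ 3 := by ring
        _ ≤ (‖D‖ ^ 2) ^ 3 := by gcongr
        _ = _ := by ring
    exact le_of_sq_le_sq h6 (by positivity)
  have hh : ‖D‖ ^ (-(1/2) : ℝ) ≤ P ^ (-(1/3) : ℝ) * d ^ (-(2/3) : ℝ) := by
    have h1 : ‖D‖ ^ (-(1/2) : ℝ) = (‖D‖ ^ 3) ^ (-(1/6) : ℝ) := by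
      rw [← Real.rpow_natCast, ← Real.rpow_mul hDpos.le]; norm_num
    have h2 : P ^ (-(1/3) : ℝ) * d ^ (-(2/3) : ℝ) = (P ^ 2 * d ^ 4) ^ (-(1/6) : ℝ) := by
      rw [Real.mul_rpow (by positivity) (by positivity), ← Real.rpow_natCast, ← Real.rpow_natCast,
        ← Real.rpow_mul hP0.le, ← Real.rpow_mul hd.le]; norm_num
    rw [h1, h2]
    exact Real.rpow_le_rpow_of_nonpos (by positivity) hcube (by norm_num)
  have hcp : ∀ y : ℝ, ‖D ^ (y : ℂ)‖ = ‖D‖ ^ y := fun y => Complex.norm_cpow_real D y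
  constructor
  · have := hcp (-(1/2))
    push_cast at this
    rw [this]; exact hh
  · have h1 := hcp (-(1/2) - 1)
    push_cast at h1
    rw [norm_mul, norm_mul, h1, Real.rpow_sub_one hDpos.ne', norm_mul]
    set w : ℂ := ((c : ℂ) + z ^ 2) * u + I * (δ * z) with hw
    have hw2 : ‖w‖ ^ 2 = n ^ 2 * (u ^ 2 + γ ^ 2) := by
      have hnγ : δ * z = n * γ := by rw [hγ]; field_simp
      have hre : w.re = n * u := by
        simp [hw, hn, pow_two]
      have him : w.im = n * γ := by
        rw [← hnγ]; simp [hw, pow_two]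
      rw [← Complex.normSq_eq_norm_sq, Complex.normSq_apply, hre, him]
      ring
    have hwd : ‖w‖ * d ≤ ‖D‖ := by
      apply le_of_sq_le_sq _ hDpos.le
      rw [mul_pow, hw2, hD, hd2]
      have : (u ^ 2 + γ ^ 2) * (u - σ) ^ 2 ≤ ((u - σ) ^ 2 + γ ^ 2) * ((u + σ) ^ 2 + γ ^ 2) := by
        rw [mul_comm]
        have e1 : (u - σ) ^ 2 ≤ (u - σ) ^ 2 + γ ^ 2 := le_add_of_nonneg_right (sq_nonneg γ)
        gcongr
      rw [mul_assoc]
      exact mul_le_mul_of_nonneg_left this (sq_nonneg n)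
    have hds : d ^ (-(5/3) : ℝ) = d ^ (-(2/3) : ℝ) / d := by
      rw [← Real.rpow_sub_one hd.ne']; norm_num
    rw [hds]
    have hc12 : ‖(-(1/2) : ℂ)‖ = 1/2 := by rw [norm_neg]; norm_num
    have hc2 : ‖(-2 : ℂ)‖ = 2 := by rw [norm_neg]; norm_num
    rw [hc12, hc2]
    calc 1 / 2 * (‖D‖ ^ (-(1/2) : ℝ) / ‖D‖) * (2 * ‖w‖) = ‖D‖ ^ (-(1/2) : ℝ) * (‖w‖ / ‖D‖) := by ring
      _ ≤ (P ^ (-(1/3) : ℝ) * d ^ (-(2/3) : ℝ)) * (1 / d) := by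
          have hq : ‖w‖ / ‖D‖ ≤ 1 / d := by
            rw [div_le_div_iff₀ hDpos hd]; linarith
          exact mul_le_mul hh hq (by positivity) (by positivity)
      _ = _ := by ring

lemma Kd_bound_real (δ τ : ℝ) (hδ : 0 < δ) (x : EuclideanSpace ℝ (Fin 3)) (hτ : τ ≠ 0)
    (h0 : x 0 ≠ 0) (h1 : x 1 ≠ 0) (h2 : x 2 ≠ 0) :
    ‖∫ ξ, kerD δ τ x ξ‖ ≤ 224 * |x 0 * x 1 * x 2| ^ (-(1/3) : ℝ) * |τ| ^ (-(1/3) : ℝ) := by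
  rw [Kd_eq δ τ hδ x h2]
  set a := x 0
  set b := x 1
  set z := x 2
  set c := a ^ 2 + b ^ 2 with hc
  have hc0 : 0 < c := by positivity
  set n := c + z ^ 2 with hn
  have hn0 : 0 < n := by positivity
  set M := |a * b * z| ^ (-(1/3) : ℝ) with hM
  have hM0 : 0 ≤ M := by positivity
  set β := Real.sqrt (c * (δ ^ 2 + n)) / n with hβ
  have hβ0 : 0 < β := by rw [hβ]; positivity
  have hβ2 : n ^ 2 * β ^ 2 = c * (δ ^ 2 + n) := by
    rw [hβ, div_pow, Real.sq_sqrt (by positivity)]; field_simp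
  have hslit := fun u : ℝ => Dfun_slit δ c z u hδ hc0.le h2
  set h : ℝ → ℂ := fun u => (Dfun δ c z u) ^ (-(1/2) : ℂ) with hh
  set h' : ℝ → ℂ := fun u => (-(1/2) : ℂ) * (Dfun δ c z u) ^ (-(1/2) - 1 : ℂ) *
      (-2 * (((c : ℝ) + z ^ 2) * u + I * (δ * z))) with hh'
  have hd : ∀ u, HasDerivAt h (h' u) u := by
    intro u
    exact ((Complex.hasStrictDerivAt_cpow_const (c := (-(1/2) : ℂ)) (hslit u)).hasDerivAt).comp u
      (Dfun_hasDerivAt δ c z u)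
  have hcont : Continuous h' := by
    rw [hh']
    have := (continuous_Dfun δ c z).cpow (continuous_const (y := (-(1/2) - 1 : ℂ))) hslit
    fun_prop
  have hcont0 : Continuous h := continuous_iff_continuousAt.2 fun u => (hd u).continuousAt
  have i1 := osc_full h h' β 0 1 M τ zero_le_one (fun u _ => hd u) hcont.continuousOn hM0
    (fun u hu hne => (amp_bounds δ a b z u β hδ h0 h1 h2 hβ2 (mul_nonneg hu.1 hβ0.le) hne).1)
    (fun u hu hne => (amp_bounds δ a b z u β hδ h0 h1 h2 hβ2 (mul_nonneg hu.1 hβ0.le) hne).2) hτ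
  have hβ2' : n ^ 2 * (-β) ^ 2 = c * (δ ^ 2 + n) := by rw [neg_sq]; exact hβ2
  have hle : ∀ u ∈ Set.Icc (-1 : ℝ) 0, 0 ≤ u * (-β) := fun u hu => by
    have := hu.2; nlinarith
  have i2 := osc_full h h' (-β) (-1) 0 M τ (by norm_num) (fun u _ => hd u) hcont.continuousOn hM0
    (fun u hu hne => (amp_bounds δ a b z u (-β) hδ h0 h1 h2 hβ2' (hle u hu) hne).1)
    (fun u hu hne => (amp_bounds δ a b z u (-β) hδ h0 h1 h2 hβ2' (hle u hu) hne).2) hτ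
  have hci : Continuous fun u : ℝ => cexp (I * (τ * u : ℝ)) * h u := by fun_prop
  have hsplit := intervalIntegral.integral_add_adjacent_intervals
    (hci.intervalIntegrable (μ := volume) (-1) 0) (hci.intervalIntegrable 0 1)
  rw [← hsplit, norm_mul]
  have hpi : ‖(2 * Real.pi : ℂ)‖ ≤ 8 := by
    rw [norm_mul, Complex.norm_real, Real.norm_of_nonneg Real.pi_pos.le]
    norm_num; linarith [Real.pi_le_four]
  calc _ ≤ 8 * (14 * M * |τ| ^ (-(1/3) : ℝ) + 14 * M * |τ| ^ (-(1/3) : ℝ)) := by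
        gcongr
        exact (norm_add_le _ _).trans (add_le_add i2 i1)
    _ = _ := by ring

lemma rieszK_eq (s : ℝ) (hs : s ≠ 0) : rieszK s = ENNReal.ofReal (|s| ^ (-(1/3) : ℝ)) := by
  rw [rieszK, Real.enorm_eq_ofReal_abs, ENNReal.ofReal_rpow_of_pos (abs_pos.mpr hs)]

lemma rieszK_zero : rieszK 0 = ⊤ := by
  simp [rieszK, ENNReal.zero_rpow_of_neg]

lemma rieszK_ne_zero (s : ℝ) : rieszK s ≠ 0 := by
  by_cases h : s = 0
  · subst h; simp [rieszK_zero]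
  · rw [rieszK_eq s h]
    have := abs_pos.mpr h
    simp only [ne_eq, ENNReal.ofReal_eq_zero, not_le]
    positivity

lemma Kd_bound (δ τ : ℝ) (hδ : 0 < δ) (x : EuclideanSpace ℝ (Fin 3)) :
    ‖∫ ξ, kerD δ τ x ξ‖ₑ ≤ 224 * bigK τ x := by
  by_cases h : τ ≠ 0 ∧ x 0 ≠ 0 ∧ x 1 ≠ 0 ∧ x 2 ≠ 0
  · obtain ⟨hτ, h0, h1, h2⟩ := h
    have := Kd_bound_real δ τ hδ x hτ h0 h1 h2
    rw [bigK, rieszK_eq _ hτ, rieszK_eq _ h0, rieszK_eq _ h1, rieszK_eq _ h2,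
      ← ENNReal.ofReal_mul (by positivity), ← ENNReal.ofReal_mul (by positivity),
      ← ENNReal.ofReal_mul (by positivity), show (224 : ℝ≥0∞) = ENNReal.ofReal 224 by simp,
      ← ENNReal.ofReal_mul (by positivity), ← ofReal_norm]
    apply ENNReal.ofReal_le_ofReal
    refine this.trans (le_of_eq ?_)
    rw [abs_mul, abs_mul, Real.mul_rpow (by positivity) (by positivity),
      Real.mul_rpow (by positivity) (by positivity)]
    ring
  · have hn := rieszK_ne_zero
    have : bigK τ x = ⊤ := by
      unfold bigK
      by_cases a1 : τ = 0
      · rw [a1, rieszK_zero]; simp [hn]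
      by_cases a2 : x 0 = 0
      · rw [a2, rieszK_zero]; simp [hn, ENNReal.mul_top, ENNReal.top_mul]
      by_cases a3 : x 1 = 0
      · rw [a3, rieszK_zero]; simp [hn, ENNReal.mul_top, ENNReal.top_mul]
      by_cases a4 : x 2 = 0
      · rw [a4, rieszK_zero]; simp [hn, ENNReal.mul_top, ENNReal.top_mul]
      exact absurd ⟨a1, a2, a3, a4⟩ h
    rw [this]; simp


/-- the phase factor -/
def phs (lam : ℝ) (p : ℝ × (EuclideanSpace ℝ (Fin 3))) (ξ : (EuclideanSpace ℝ (Fin 3))) : ℂ := cexp (I * ofReal (⟪p.2, ξ⟫ + lam * p.1 * pRot ξ))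

lemma norm_phs (lam : ℝ) (p : ℝ × (EuclideanSpace ℝ (Fin 3))) (ξ : (EuclideanSpace ℝ (Fin 3))) : ‖phs lam p ξ‖ = 1 := by
  rw [phs, mul_comm, Complex.norm_exp_ofReal_mul_I]

lemma measurable_phs {α : Type*} [MeasurableSpace α] (lam : ℝ) {f : α → ℝ × (EuclideanSpace ℝ (Fin 3))} {g : α → (EuclideanSpace ℝ (Fin 3))}
    (hf : Measurable f) (hg : Measurable g) : Measurable fun a => phs lam (f a) (g a) := by
  have := measurable_pRot
  have := hf.fst
  have := hf.snd
  unfold phs; fun_prop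

lemma phs_mul_conj (lam : ℝ) (p q : ℝ × (EuclideanSpace ℝ (Fin 3))) (ξ : (EuclideanSpace ℝ (Fin 3))) :
    phs lam p ξ * (starRingEnd ℂ) (phs lam q ξ) =
      cexp (I * ofReal (⟪p.2 - q.2, ξ⟫ + lam * (p.1 - q.1) * pRot ξ)) := by
  rw [phs, phs, ← Complex.exp_conj, ← Complex.exp_add, map_mul, Complex.conj_I, Complex.conj_ofReal,
    inner_sub_left]
  congr 1
  push_cast; ring

/-- space-time Fourier transform along the characteristic surface -/
def Ft (lam : ℝ) (F : ℝ × (EuclideanSpace ℝ (Fin 3)) → ℂ) (ξ : (EuclideanSpace ℝ (Fin 3))) : ℂ := ∫ p, F p * phs lam p ξ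

/-- regularised weight -/
def wgt (δ : ℝ) (ξ : (EuclideanSpace ℝ (Fin 3))) : ℝ := (‖ξ‖ ^ 2)⁻¹ * Real.exp (-δ * ‖ξ‖)

lemma wgt_nonneg (δ : ℝ) (ξ : (EuclideanSpace ℝ (Fin 3))) : 0 ≤ wgt δ ξ := by unfold wgt; positivity

lemma measurable_wgt (δ : ℝ) : Measurable (wgt δ) := by unfold wgt; fun_prop

lemma integrable_wgt (δ : ℝ) (hδ : 0 < δ) : Integrable (wgt δ) := by
  have := (integrable_kerD δ 0 hδ 0).norm
  refine this.congr (Filter.Eventually.of_forall fun ξ => ?_)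
  simp only [kerD]
  rw [norm_mul, mul_comm I, Complex.norm_exp_ofReal_mul_I, one_mul, Complex.norm_real,
    Real.norm_of_nonneg (by positivity)]
  rfl

lemma measurable_Ft (lam : ℝ) (F : ℝ × (EuclideanSpace ℝ (Fin 3)) → ℂ) (hF : Measurable F) : Measurable (Ft lam F) := by
  have h : Measurable fun q : (EuclideanSpace ℝ (Fin 3)) × (ℝ × (EuclideanSpace ℝ (Fin 3))) => F q.2 * phs lam q.2 q.1 :=
    (hF.comp measurable_snd).mul (measurable_phs lam measurable_snd measurable_fst)
  exact (StronglyMeasurable.integral_prod_right' h.stronglyMeasurable).measurable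

lemma rieszK_mul (a b : ℝ) : rieszK (a * b) = rieszK a * rieszK b := by
  rw [rieszK, enorm_mul, ENNReal.mul_rpow_of_ne_top enorm_ne_top enorm_ne_top]; rfl

lemma Ft_weighted (lam : ℝ) (F : ℝ × (EuclideanSpace ℝ (Fin 3)) → ℂ) (hF : Measurable F) (hFi : Integrable F)
    (δ : ℝ) (hδ : 0 < δ) :
    ∫⁻ ξ, ENNReal.ofReal (wgt δ ξ) * ‖Ft lam F ξ‖ₑ ^ 2 ≤
      224 * rieszK lam * (16 * (16 * (16 * 16))) *
        ((∫⁻ p, ‖F p‖ₑ ^ (6/5 : ℝ)) ^ (5/6 : ℝ) * (∫⁻ p, ‖F p‖ₑ ^ (6/5 : ℝ)) ^ (5/6 : ℝ)) := by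
  have hwi := integrable_wgt δ hδ
  set H : (EuclideanSpace ℝ (Fin 3)) × ((ℝ × (EuclideanSpace ℝ (Fin 3))) × (ℝ × (EuclideanSpace ℝ (Fin 3)))) → ℂ := fun q => (wgt δ q.1 : ℂ) *
    ((F q.2.1 * phs lam q.2.1 q.1) * (starRingEnd ℂ) (F q.2.2 * phs lam q.2.2 q.1)) with hH
  have hHm : Measurable H := by
    have m1 := measurable_wgt δ
    have m3 : Measurable fun q : (EuclideanSpace ℝ (Fin 3)) × ((ℝ × (EuclideanSpace ℝ (Fin 3))) × (ℝ × (EuclideanSpace ℝ (Fin 3)))) => phs lam q.2.1 q.1 :=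
      measurable_phs lam (by fun_prop) (by fun_prop)
    have m4 : Measurable fun q : (EuclideanSpace ℝ (Fin 3)) × ((ℝ × (EuclideanSpace ℝ (Fin 3))) × (ℝ × (EuclideanSpace ℝ (Fin 3)))) => phs lam q.2.2 q.1 :=
      measurable_phs lam (by fun_prop) (by fun_prop)
    have mc : Measurable (starRingEnd ℂ) := Complex.continuous_conj.measurable
    apply Measurable.mul (by fun_prop)
    have m5 : Measurable fun q : (EuclideanSpace ℝ (Fin 3)) × ((ℝ × (EuclideanSpace ℝ (Fin 3))) × (ℝ × (EuclideanSpace ℝ (Fin 3)))) => F q.2.1 * phs lam q.2.1 q.1 :=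
      Measurable.mul (by fun_prop) m3
    have m6 : Measurable fun q : (EuclideanSpace ℝ (Fin 3)) × ((ℝ × (EuclideanSpace ℝ (Fin 3))) × (ℝ × (EuclideanSpace ℝ (Fin 3)))) => F q.2.2 * phs lam q.2.2 q.1 :=
      Measurable.mul (by fun_prop) m4
    exact m5.mul (mc.comp m6)
  have hHi : Integrable H (volume.prod (volume.prod volume)) := by
    have h1 : Integrable (fun q : (ℝ × (EuclideanSpace ℝ (Fin 3))) × (ℝ × (EuclideanSpace ℝ (Fin 3))) => ‖F q.1‖ * ‖F q.2‖) (volume.prod volume) :=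
      hFi.norm.mul_prod hFi.norm
    have h2 := hwi.mul_prod h1
    refine h2.mono' hHm.aestronglyMeasurable (Filter.Eventually.of_forall fun q => ?_)
    rw [hH]; simp only
    rw [norm_mul, norm_mul, RCLike.norm_conj, norm_mul, norm_mul, norm_phs, norm_phs, mul_one, mul_one,
      Complex.norm_real, Real.norm_of_nonneg (wgt_nonneg δ _)]
  have hinner : ∀ ξ, ∫ q : (ℝ × (EuclideanSpace ℝ (Fin 3))) × (ℝ × (EuclideanSpace ℝ (Fin 3))), H (ξ, q) ∂(volume.prod volume)
      = (wgt δ ξ * ‖Ft lam F ξ‖ ^ 2 : ℝ) := by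
    intro ξ
    rw [hH]; simp only
    rw [integral_const_mul, integral_prod_mul (fun p => F p * phs lam p ξ)
      (fun p => (starRingEnd ℂ) (F p * phs lam p ξ)), integral_conj]
    have : (∫ p, F p * phs lam p ξ) = Ft lam F ξ := rfl
    rw [this, Complex.mul_conj, Complex.normSq_eq_norm_sq]
    push_cast; rfl
  have hI : Integrable fun ξ => wgt δ ξ * ‖Ft lam F ξ‖ ^ 2 := by
    have := hHi.integral_prod_left
    simp only [hinner] at this
    exact this.re.congr (Filter.Eventually.of_forall fun ξ => by
      simp only [RCLike.re_eq_complex_re, Complex.ofReal_re])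
  have hL : ∫⁻ ξ, ENNReal.ofReal (wgt δ ξ) * ‖Ft lam F ξ‖ₑ ^ 2 =
      ‖∫ ξ, ((wgt δ ξ * ‖Ft lam F ξ‖ ^ 2 : ℝ) : ℂ)‖ₑ := by
    rw [integral_complex_ofReal, ← ofReal_norm, Complex.norm_real, Real.norm_of_nonneg
      (integral_nonneg fun ξ => mul_nonneg (wgt_nonneg _ _) (sq_nonneg _)),
      ofReal_integral_eq_lintegral_ofReal hI
        (Filter.Eventually.of_forall fun ξ => mul_nonneg (wgt_nonneg _ _) (sq_nonneg _))]
    apply lintegral_congr; intro ξ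
    rw [ENNReal.ofReal_mul (wgt_nonneg _ _), ENNReal.ofReal_pow (norm_nonneg _), ofReal_norm]
  rw [hL]
  simp only [← hinner]
  rw [integral_integral_swap hHi]
  have hker : ∀ q : (ℝ × (EuclideanSpace ℝ (Fin 3))) × (ℝ × (EuclideanSpace ℝ (Fin 3))), ∫ ξ, H (ξ, q) = F q.1 * (starRingEnd ℂ) (F q.2) *
      ∫ ξ, kerD δ (lam * (q.1.1 - q.2.1)) (q.1.2 - q.2.2) ξ := by
    intro q
    rw [← integral_const_mul]
    congr 1; ext ξ
    rw [hH]; simp only [kerD]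
    rw [← phs_mul_conj, map_mul, wgt]; ring
  simp only [hker]
  have hHLS := isHLS_bigK
  calc _ ≤ ∫⁻ q : (ℝ × (EuclideanSpace ℝ (Fin 3))) × (ℝ × (EuclideanSpace ℝ (Fin 3))), ‖F q.1 * (starRingEnd ℂ) (F q.2) *
      ∫ ξ, kerD δ (lam * (q.1.1 - q.2.1)) (q.1.2 - q.2.2) ξ‖ₑ ∂(volume.prod volume) :=
        enorm_integral_le_lintegral_enorm _
    _ ≤ ∫⁻ q : (ℝ × (EuclideanSpace ℝ (Fin 3))) × (ℝ × (EuclideanSpace ℝ (Fin 3))), (224 * rieszK lam) * (‖F q.1‖ₑ * ‖F q.2‖ₑ *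
          bigK (q.1.1 - q.2.1) (q.1.2 - q.2.2)) ∂(volume.prod volume) := by
        apply lintegral_mono; intro q
        simp only
        rw [enorm_mul, enorm_mul, RCLike.enorm_conj]
        calc _ ≤ ‖F q.1‖ₑ * ‖F q.2‖ₑ * (224 * bigK (lam * (q.1.1 - q.2.1)) (q.1.2 - q.2.2)) := by
              gcongr; exact Kd_bound δ _ hδ _
          _ = _ := by
              rw [bigK, rieszK_mul, bigK]; ring
    _ = (224 * rieszK lam) * ∫⁻ p : ℝ × (EuclideanSpace ℝ (Fin 3)), ∫⁻ q : ℝ × (EuclideanSpace ℝ (Fin 3)), ‖F p‖ₑ * ‖F q‖ₑ *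
          bigK (p.1 - q.1) (p.2 - q.2) := by
        have hm : Measurable fun q : (ℝ × (EuclideanSpace ℝ (Fin 3))) × (ℝ × (EuclideanSpace ℝ (Fin 3))) => ‖F q.1‖ₑ * ‖F q.2‖ₑ *
          bigK (q.1.1 - q.2.1) (q.1.2 - q.2.2) :=
          ((by fun_prop : Measurable fun q : (ℝ × (EuclideanSpace ℝ (Fin 3))) × (ℝ × (EuclideanSpace ℝ (Fin 3))) => ‖F q.1‖ₑ * ‖F q.2‖ₑ)).mul hHLS.1
        rw [lintegral_const_mul _ hm, lintegral_prod _ hm.aemeasurable]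
    _ ≤ (224 * rieszK lam) * ((16 * (16 * (16 * 16))) *
        ((∫⁻ p, ‖F p‖ₑ ^ (6/5 : ℝ)) ^ (5/6 : ℝ) * (∫⁻ p, ‖F p‖ₑ ^ (6/5 : ℝ)) ^ (5/6 : ℝ))) := by
        gcongr
        exact hHLS.2 _ _ hF.enorm hF.enorm
    _ = _ := by ring

lemma Ft_limit (lam : ℝ) (F : ℝ × (EuclideanSpace ℝ (Fin 3)) → ℂ) (hF : Measurable F) (hFi : Integrable F) :
    ∫⁻ ξ, ENNReal.ofReal ((‖ξ‖ ^ 2)⁻¹) * ‖Ft lam F ξ‖ₑ ^ 2 ≤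
      224 * rieszK lam * (16 * (16 * (16 * 16))) *
        ((∫⁻ p, ‖F p‖ₑ ^ (6/5 : ℝ)) ^ (5/6 : ℝ) * (∫⁻ p, ‖F p‖ₑ ^ (6/5 : ℝ)) ^ (5/6 : ℝ)) := by
  have hFm := measurable_Ft lam F hF
  have hseq : Filter.Tendsto (fun n : ℕ => (1 : ℝ) / (n + 1)) Filter.atTop (nhds 0) :=
    tendsto_one_div_add_atTop_nhds_zero_nat
  have ht := lintegral_tendsto_of_tendsto_of_monotone (μ := volume)
    (f := fun (n : ℕ) (ξ : (EuclideanSpace ℝ (Fin 3))) => ENNReal.ofReal (wgt (1 / (n + 1)) ξ) * ‖Ft lam F ξ‖ₑ ^ 2)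
    (F := fun ξ => ENNReal.ofReal ((‖ξ‖ ^ 2)⁻¹) * ‖Ft lam F ξ‖ₑ ^ 2)
    (fun n => by
      have := measurable_wgt (1 / (n + 1))
      exact (by fun_prop : Measurable _).aemeasurable)
    (Filter.Eventually.of_forall fun ξ => by
      intro m n hmn
      simp only [wgt]
      gcongr)
    (Filter.Eventually.of_forall fun ξ => by
      apply ENNReal.Tendsto.mul_const _ (Or.inr (by finiteness))
      apply ENNReal.tendsto_ofReal
      have : Filter.Tendsto (fun n : ℕ => (‖ξ‖ ^ 2)⁻¹ * Real.exp (-(1 / ((n : ℝ) + 1)) * ‖ξ‖))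
        Filter.atTop (nhds ((‖ξ‖ ^ 2)⁻¹ * Real.exp (-0 * ‖ξ‖))) := by
        apply Filter.Tendsto.const_mul
        exact (Real.continuous_exp.tendsto _).comp ((hseq.neg).mul_const _)
      simpa [wgt] using this)
  refine le_of_tendsto' ht fun n => Ft_weighted lam F hF hFi _ (by positivity)

/-- free evolution of a frequency profile -/
def Wg (lam : ℝ) (g : (EuclideanSpace ℝ (Fin 3)) → ℂ) (p : ℝ × (EuclideanSpace ℝ (Fin 3))) : ℂ := ∫ ξ, phs lam p ξ * g ξ

lemma dual_est (lam : ℝ) (F : ℝ × (EuclideanSpace ℝ (Fin 3)) → ℂ) (hF : Measurable F) (hFi : Integrable F)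
    (g : (EuclideanSpace ℝ (Fin 3)) → ℂ) (hg : Measurable g) (hgi : Integrable g) :
    ‖∫ p, F p * Wg lam g p‖ₑ ≤ (∫⁻ ξ, ‖ξ‖ₑ ^ 2 * ‖g ξ‖ₑ ^ 2) ^ (1/2 : ℝ) *
      ((224 * rieszK lam * (16 * (16 * (16 * 16)))) ^ (1/2 : ℝ) *
        (∫⁻ p, ‖F p‖ₑ ^ (6/5 : ℝ)) ^ (5/6 : ℝ)) := by
  set H : (ℝ × (EuclideanSpace ℝ (Fin 3))) × (EuclideanSpace ℝ (Fin 3)) → ℂ := fun q => F q.1 * (phs lam q.1 q.2 * g q.2) with hH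
  have m2 : Measurable fun q : (ℝ × (EuclideanSpace ℝ (Fin 3))) × (EuclideanSpace ℝ (Fin 3)) => phs lam q.1 q.2 := measurable_phs lam measurable_fst measurable_snd
  have hHm : Measurable H := (hF.comp measurable_fst).mul (m2.mul (hg.comp measurable_snd))
  have hHi : Integrable H (volume.prod volume) := by
    refine (hFi.norm.mul_prod hgi.norm).mono' hHm.aestronglyMeasurable
      (Filter.Eventually.of_forall fun q => ?_)
    rw [hH]; simp only
    rw [norm_mul, norm_mul, norm_phs, one_mul]
  have h1 : ∫ p, F p * Wg lam g p = ∫ ξ, Ft lam F ξ * g ξ := by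
    have e1 : ∀ p, F p * Wg lam g p = ∫ ξ, H (p, ξ) := by
      intro p; rw [Wg, ← integral_const_mul]
    have e2 : ∀ ξ, Ft lam F ξ * g ξ = ∫ p, H (p, ξ) := by
      intro ξ; rw [Ft, ← integral_mul_const]; congr 1; ext p; rw [hH]; ring
    simp only [e1, e2]
    exact integral_integral_swap hHi
  rw [h1]
  have hFm := measurable_Ft lam F hF
  have hae : ∀ᵐ ξ : (EuclideanSpace ℝ (Fin 3)), ξ ≠ 0 := by
    rw [ae_iff]; simp
  set A := 224 * rieszK lam * (16 * (16 * (16 * 16)))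
  calc _ ≤ ∫⁻ ξ, ‖Ft lam F ξ * g ξ‖ₑ := enorm_integral_le_lintegral_enorm _
    _ = ∫⁻ ξ, (‖ξ‖ₑ * ‖g ξ‖ₑ) * (ENNReal.ofReal ‖ξ‖⁻¹ * ‖Ft lam F ξ‖ₑ) := by
        apply lintegral_congr_ae
        filter_upwards [hae] with ξ hξ
        rw [enorm_mul, ← ofReal_norm ξ]
        have : ENNReal.ofReal ‖ξ‖ * ENNReal.ofReal ‖ξ‖⁻¹ = 1 := by
          rw [← ENNReal.ofReal_mul (norm_nonneg _), mul_inv_cancel₀ (norm_ne_zero_iff.mpr hξ)]; simp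
        calc _ = (ENNReal.ofReal ‖ξ‖ * ENNReal.ofReal ‖ξ‖⁻¹) * (‖Ft lam F ξ‖ₑ * ‖g ξ‖ₑ) := by
              rw [this, one_mul]
          _ = _ := by ring
    _ ≤ (∫⁻ ξ, (‖ξ‖ₑ * ‖g ξ‖ₑ) ^ (2:ℝ)) ^ (1/2 : ℝ) *
        (∫⁻ ξ, (ENNReal.ofReal ‖ξ‖⁻¹ * ‖Ft lam F ξ‖ₑ) ^ (2:ℝ)) ^ (1/2 : ℝ) := by
        exact ENNReal.lintegral_mul_le_Lp_mul_Lq volume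
          (Real.HolderConjugate.two_two) (by fun_prop) (by fun_prop)
    _ = (∫⁻ ξ, ‖ξ‖ₑ ^ 2 * ‖g ξ‖ₑ ^ 2) ^ (1/2 : ℝ) *
        (∫⁻ ξ, ENNReal.ofReal ((‖ξ‖ ^ 2)⁻¹) * ‖Ft lam F ξ‖ₑ ^ 2) ^ (1/2 : ℝ) := by
        congr 2
        · apply lintegral_congr; intro ξ
          rw [ENNReal.rpow_two, mul_pow]
        · congr 1; ext ξ
          rw [ENNReal.rpow_two, mul_pow, ← ENNReal.ofReal_pow (by positivity), inv_pow]
    _ ≤ (∫⁻ ξ, ‖ξ‖ₑ ^ 2 * ‖g ξ‖ₑ ^ 2) ^ (1/2 : ℝ) * (A * ((∫⁻ p, ‖F p‖ₑ ^ (6/5 : ℝ)) ^ (5/6 : ℝ) *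
          (∫⁻ p, ‖F p‖ₑ ^ (6/5 : ℝ)) ^ (5/6 : ℝ))) ^ (1/2 : ℝ) := by
        gcongr
        exact Ft_limit lam F hF hFi
    _ = _ := by
        rw [ENNReal.mul_rpow_of_nonneg _ _ (by norm_num), ← pow_two, ← ENNReal.rpow_natCast_mul]
        norm_num

lemma measurable_Wg (lam : ℝ) (g : (EuclideanSpace ℝ (Fin 3)) → ℂ) (hg : Measurable g) : Measurable (Wg lam g) := by
  have h : Measurable fun q : (ℝ × (EuclideanSpace ℝ (Fin 3))) × (EuclideanSpace ℝ (Fin 3)) => phs lam q.1 q.2 * g q.2 :=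
    (measurable_phs lam measurable_fst measurable_snd).mul (by fun_prop)
  exact (StronglyMeasurable.integral_prod_right' h.stronglyMeasurable).measurable

lemma norm_Wg_le (lam : ℝ) (g : (EuclideanSpace ℝ (Fin 3)) → ℂ) (p : ℝ × (EuclideanSpace ℝ (Fin 3))) : ‖Wg lam g p‖ ≤ ∫ ξ, ‖g ξ‖ := by
  refine (norm_integral_le_integral_norm _).trans (le_of_eq ?_)
  congr 1; ext ξ; rw [norm_mul, norm_phs, one_mul]

lemma dual_abs (lam : ℝ) (G : ℝ × (EuclideanSpace ℝ (Fin 3)) → ℝ≥0∞) (hG : Measurable G) (hGi : ∫⁻ p, G p ≠ ⊤)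
    (hGf : ∀ p, G p ≠ ⊤) (g : (EuclideanSpace ℝ (Fin 3)) → ℂ) (hg : Measurable g) (hgi : Integrable g) :
    ∫⁻ p, ‖Wg lam g p‖ₑ * G p ≤ (∫⁻ ξ, ‖ξ‖ₑ ^ 2 * ‖g ξ‖ₑ ^ 2) ^ (1/2 : ℝ) *
      ((224 * rieszK lam * (16 * (16 * (16 * 16)))) ^ (1/2 : ℝ) *
        (∫⁻ p, G p ^ (6/5 : ℝ)) ^ (5/6 : ℝ)) := by
  have hW := measurable_Wg lam g hg
  set W := Wg lam g with hWd
  set F : ℝ × (EuclideanSpace ℝ (Fin 3)) → ℂ := fun p => ((G p).toReal : ℂ) * ((starRingEnd ℂ) (W p) / (‖W p‖ : ℂ)) with hF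
  have mc : Measurable fun p => (starRingEnd ℂ) (W p) := Complex.continuous_conj.measurable.comp hW
  have hFm : Measurable F := by rw [hF]; fun_prop
  have hFn : ∀ p, ‖F p‖ ≤ (G p).toReal := by
    intro p
    rw [hF]; simp only
    rw [norm_mul, norm_div, RCLike.norm_conj, Complex.norm_real, Complex.norm_real, norm_norm,
      Real.norm_of_nonneg ENNReal.toReal_nonneg]
    exact mul_le_of_le_one_right ENNReal.toReal_nonneg (div_self_le_one _)
  have hFe : ∀ p, ‖F p‖ₑ ≤ G p := by
    intro p
    rw [← ofReal_norm]
    exact ENNReal.ofReal_le_of_le_toReal (hFn p)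
  have hFi : Integrable F := by
    refine ⟨hFm.aestronglyMeasurable, ?_⟩
    exact lt_of_le_of_lt (lintegral_mono hFe) hGi.lt_top
  have hFW : ∀ p, F p * W p = ((‖W p‖ * (G p).toReal : ℝ) : ℂ) := by
    intro p
    rw [hF]; simp only
    by_cases h : W p = 0
    · simp [h]
    · have h2 : (‖W p‖ : ℂ) ≠ 0 := by exact_mod_cast norm_ne_zero_iff.mpr h
      have h3 : (starRingEnd ℂ) (W p) * W p = (‖W p‖ : ℂ) ^ 2 := by
        rw [mul_comm, Complex.mul_conj, Complex.normSq_eq_norm_sq]; push_cast; rfl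
      push_cast
      field_simp
      rw [mul_assoc, h3]
  have hIntg : Integrable fun p => ‖W p‖ * (G p).toReal := by
    have h1 : Integrable fun p => (G p).toReal := integrable_toReal_of_lintegral_ne_top hG.aemeasurable hGi
    refine (h1.const_mul (∫ ξ, ‖g ξ‖)).mono' (by fun_prop) (Filter.Eventually.of_forall fun p => ?_)
    rw [Real.norm_of_nonneg (by positivity)]
    gcongr
    exact norm_Wg_le lam g p
  have hL : ∫⁻ p, ‖W p‖ₑ * G p = ‖∫ p, F p * W p‖ₑ := by
    simp only [hFW]
    rw [integral_complex_ofReal, ← ofReal_norm, Complex.norm_real, Real.norm_of_nonneg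
      (integral_nonneg fun p => by positivity), ofReal_integral_eq_lintegral_ofReal hIntg
        (Filter.Eventually.of_forall fun p => by positivity)]
    apply lintegral_congr; intro p
    rw [ENNReal.ofReal_mul (norm_nonneg _), ofReal_norm, ENNReal.ofReal_toReal (hGf p)]
  rw [hL]
  refine (dual_est lam F hFm hFi g hg hgi).trans ?_
  gcongr with p
  exact hFe p

lemma dual_to_L6 {α : Type*} [MeasurableSpace α] (μ : Measure α) [SigmaFinite μ]
    (H : α → ℝ≥0∞) (hH : Measurable H) (K : ℝ≥0∞)
    (h : ∀ G : α → ℝ≥0∞, Measurable G → ∫⁻ p, G p ∂μ ≠ ⊤ → (∀ p, G p ≠ ⊤) →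
      ∫⁻ p, H p * G p ∂μ ≤ K * (∫⁻ p, G p ^ (6/5 : ℝ) ∂μ) ^ (5/6 : ℝ)) :
    ∫⁻ p, H p ^ 6 ∂μ ≤ K ^ 6 := by
  set Hn : ℕ → α → ℝ≥0∞ := fun n p => (spanningSets μ n).indicator (fun p => min (H p) n) p with hHn
  have mHn : ∀ n, Measurable (Hn n) := fun n =>
    Measurable.indicator (hH.min measurable_const) (measurableSet_spanningSets μ n)
  have hle : ∀ n p, Hn n p ≤ n := by
    intro n p; rw [hHn]; simp only
    by_cases hp : p ∈ spanningSets μ n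
    · rw [Set.indicator_of_mem hp]; exact min_le_right _ _
    · rw [Set.indicator_of_notMem hp]; exact bot_le
  have hleH : ∀ n p, Hn n p ≤ H p := by
    intro n p; rw [hHn]; simp only
    by_cases hp : p ∈ spanningSets μ n
    · rw [Set.indicator_of_mem hp]; exact min_le_left _ _
    · rw [Set.indicator_of_notMem hp]; exact bot_le
  have hfin : ∀ (n k : ℕ), k ≠ 0 → ∫⁻ p, Hn n p ^ k ∂μ ≠ ⊤ := by
    intro n k hk
    have h1 : ∫⁻ p, Hn n p ^ k ∂μ ≤ ∫⁻ p, (spanningSets μ n).indicator (fun _ => (n : ℝ≥0∞) ^ k) p ∂μ := by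
      apply lintegral_mono; intro p
      by_cases hp : p ∈ spanningSets μ n
      · simp only [Set.indicator_of_mem hp]
        gcongr; exact hle n p
      · rw [hHn]; simp [Set.indicator_of_notMem hp, hk]
    refine ne_top_of_le_ne_top ?_ h1
    rw [lintegral_indicator (measurableSet_spanningSets μ n), setLIntegral_const]
    exact ENNReal.mul_ne_top (by finiteness) (measure_spanningSets_lt_top μ n).ne
  have hn6 : ∀ n, ∫⁻ p, Hn n p ^ 6 ∂μ ≤ K ^ 6 := by
    intro n
    set J := ∫⁻ p, Hn n p ^ 6 ∂μ with hJ
    have hJf : J ≠ ⊤ := hfin n 6 (by norm_num)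
    have h1 := h (fun p => Hn n p ^ 5) ((mHn n).pow_const 5) (hfin n 5 (by norm_num)) (fun p =>
      ENNReal.pow_ne_top (ne_top_of_le_ne_top (by finiteness) (hle n p)))
    have h2 : ∫⁻ p, (Hn n p ^ 5) ^ (6/5 : ℝ) ∂μ = J := by
      apply lintegral_congr; intro p
      rw [← ENNReal.rpow_natCast_mul, ← ENNReal.rpow_natCast]; norm_num
    rw [h2] at h1
    have h3 : J ≤ K * J ^ (5/6 : ℝ) := by
      refine le_trans ?_ h1
      apply lintegral_mono; intro p
      simp only
      rw [pow_succ' _ 5]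
      gcongr; exact hleH n p
    by_cases hJ0 : J = 0
    · rw [hJ0]; exact bot_le
    have h4 : J = J ^ (1/6 : ℝ) * J ^ (5/6 : ℝ) := by
      rw [← ENNReal.rpow_add _ _ hJ0 hJf]; norm_num
    have h5 : J ^ (1/6 : ℝ) ≤ K := by
      have hne : J ^ (5/6 : ℝ) ≠ 0 := by simp [hJ0, hJf]
      have hnt : J ^ (5/6 : ℝ) ≠ ⊤ := by simp [hJ0, hJf]
      rw [h4] at h3
      nth_rewrite 2 [← h4] at h3
      exact (ENNReal.mul_le_mul_iff_left hne hnt).mp h3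
    calc J = (J ^ (1/6 : ℝ)) ^ 6 := by
          rw [← ENNReal.rpow_mul_natCast]; norm_num
      _ ≤ K ^ 6 := by gcongr
  have hmono : ∀ p, Monotone fun n => Hn n p ^ 6 := by
    intro p m n hmn
    simp only
    gcongr
    rw [hHn]; simp only
    by_cases hp : p ∈ spanningSets μ m
    · rw [Set.indicator_of_mem hp, Set.indicator_of_mem (monotone_spanningSets μ hmn hp)]
      gcongr
    · rw [Set.indicator_of_notMem hp]; exact bot_le
  have hlim : ∀ p, Filter.Tendsto (fun n => Hn n p ^ 6) Filter.atTop (nhds (H p ^ 6)) := by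
    intro p
    apply (ENNReal.continuous_pow 6).tendsto _ |>.comp
    have h1 : ∀ᶠ n in Filter.atTop, p ∈ spanningSets μ n := by
      filter_upwards [Filter.eventually_ge_atTop (spanningSetsIndex μ p)] with n hn
      exact mem_spanningSets_of_index_le μ p hn
    have h2 : Filter.Tendsto (fun n : ℕ => min (H p) n) Filter.atTop (nhds (min (H p) ⊤)) :=
      tendsto_const_nhds.min ENNReal.tendsto_nat_nhds_top
    rw [min_eq_left le_top] at h2
    refine h2.congr' ?_
    filter_upwards [h1] with n hn
    rw [hHn]; simp only; rw [Set.indicator_of_mem hn]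
  have ht := lintegral_tendsto_of_tendsto_of_monotone (μ := μ) (f := fun n p => Hn n p ^ 6)
    (F := fun p => H p ^ 6) (fun n => ((mHn n).pow_const 6).aemeasurable)
    (Filter.Eventually.of_forall hmono) (Filter.Eventually.of_forall hlim)
  exact le_of_tendsto' ht hn6


lemma slice_deriv_bound (f : SchwartzMap (ℝ × (EuclideanSpace ℝ (Fin 3))) ℂ) : ∃ C : ℝ, 0 ≤ C ∧ ∀ n : ℕ, n ≤ 4 →
    ∀ (t : ℝ) (x : (EuclideanSpace ℝ (Fin 3))), ‖iteratedFDeriv ℝ n (fun x : (EuclideanSpace ℝ (Fin 3)) => f (t, x)) x‖ ≤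
      C * ((1 + |t|) ^ 4)⁻¹ * ((1 + ‖x‖) ^ 4)⁻¹ := by
  refine ⟨2 ^ 8 * (Finset.Iic ((8, 4) : ℕ × ℕ)).sup
    (fun m => SchwartzMap.seminorm ℝ m.1 m.2) f, by positivity, ?_⟩
  intro n hn t x
  have h1 := SchwartzMap.one_add_le_sup_seminorm_apply (𝕜 := ℝ) (m := (8, 4)) (k := 8) (n := n)
    le_rfl hn f (t, x)
  have h2 : ‖iteratedFDeriv ℝ n (fun x : (EuclideanSpace ℝ (Fin 3)) => f (t, x)) x‖ ≤ ‖iteratedFDeriv ℝ n f (t, x)‖ := by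
    have e : (fun x : (EuclideanSpace ℝ (Fin 3)) => f (t, x)) =
        (fun z : ℝ × (EuclideanSpace ℝ (Fin 3)) => f ((t, 0) + z)) ∘ (ContinuousLinearMap.inr ℝ ℝ (EuclideanSpace ℝ (Fin 3))) := by
      funext y; simp
    rw [e, ContinuousLinearMap.iteratedFDeriv_comp_right (i := n) (n := n)]
    · refine (ContinuousMultilinearMap.norm_compContinuousLinearMap_le _ _).trans ?_
      rw [iteratedFDeriv_comp_add_left]
      simp only [ContinuousLinearMap.inr_apply, Prod.mk_add_mk, add_zero, zero_add]
      refine mul_le_of_le_one_right (norm_nonneg _) ?_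
      refine Finset.prod_le_one (fun _ _ => norm_nonneg _) (fun _ _ => ?_)
      exact ContinuousLinearMap.norm_inr_le_one ℝ ℝ (EuclideanSpace ℝ (Fin 3))
    · exact (f.smooth n).comp (contDiff_const.add contDiff_id)
    · exact le_rfl
  have h3 : (1 + |t|) ^ 4 * (1 + ‖x‖) ^ 4 ≤ (1 + ‖(t, x)‖) ^ 8 := by
    have a1 : |t| ≤ ‖(t, x)‖ := norm_fst_le (t, x)
    have a2 : ‖x‖ ≤ ‖(t, x)‖ := norm_snd_le (t, x)
    calc _ ≤ (1 + ‖(t, x)‖) ^ 4 * (1 + ‖(t, x)‖) ^ 4 := by gcongr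
      _ = _ := by ring
  rw [← div_eq_mul_inv, ← div_eq_mul_inv, div_div, le_div_iff₀ (by positivity)]
  refine le_trans ?_ h1
  rw [mul_comm]
  gcongr

lemma slice_contDiff (f : SchwartzMap (ℝ × (EuclideanSpace ℝ (Fin 3))) ℂ) (t : ℝ) (n : ℕ∞) :
    ContDiff ℝ n (fun x : (EuclideanSpace ℝ (Fin 3)) => f (t, x)) :=
  (f.smooth n).comp (contDiff_const.prodMk contDiff_id)

lemma integrable_japanese (m : ℕ) (hm : 4 ≤ m) :
    Integrable (fun x : (EuclideanSpace ℝ (Fin 3)) => ((1 + ‖x‖) ^ m)⁻¹) := by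
  have := integrable_one_add_norm (E := (EuclideanSpace ℝ (Fin 3))) (μ := volume) (r := (m : ℝ)) (by
    simp only [finrank_euclideanSpace, Fintype.card_fin]
    have : (4 : ℝ) ≤ m := by exact_mod_cast hm
    push_cast; linarith)
  refine this.congr (Filter.Eventually.of_forall fun x => ?_)
  simp only
  rw [Real.rpow_neg (by positivity), Real.rpow_natCast]

lemma integrable_japanese1 (m : ℕ) (hm : 2 ≤ m) :
    Integrable (fun x : ℝ => ((1 + |x|) ^ m)⁻¹) := by
  have := integrable_one_add_norm (E := ℝ) (μ := volume) (r := (m : ℝ)) (by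
    simp only [Module.finrank_self]
    have : (2 : ℝ) ≤ m := by exact_mod_cast hm
    push_cast; linarith)
  refine this.congr (Filter.Eventually.of_forall fun x => ?_)
  simp only [Real.norm_eq_abs]
  rw [Real.rpow_neg (by positivity), Real.rpow_natCast]

lemma fourierTf_eq_fourier (h : (EuclideanSpace ℝ (Fin 3)) → ℂ) (ξ : (EuclideanSpace ℝ (Fin 3))) :
    fourierTf h ξ = FourierTransform.fourier h ((2 * Real.pi)⁻¹ • ξ) := by
  rw [fourierTf, Real.fourier_eq']
  congr 1
  funext x
  rw [inner_smul_right, smul_eq_mul]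
  congr 2
  have : (Real.pi : ℂ) ≠ 0 := by exact_mod_cast Real.pi_ne_zero
  push_cast
  field_simp

lemma fourier_slice_decay (f : SchwartzMap (ℝ × (EuclideanSpace ℝ (Fin 3))) ℂ) : ∃ C : ℝ, 0 ≤ C ∧
    ∀ (t : ℝ) (ξ : (EuclideanSpace ℝ (Fin 3))), ‖fourierTf (fun x : (EuclideanSpace ℝ (Fin 3)) => f (t, x)) ξ‖ ≤
      C * ((1 + |t|) ^ 4)⁻¹ * ((1 + ‖ξ‖) ^ 4)⁻¹ := by
  obtain ⟨C, hC, hb⟩ := slice_deriv_bound f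
  set J : ℝ := ∫ x : (EuclideanSpace ℝ (Fin 3)), ((1 + ‖x‖) ^ 4)⁻¹ with hJ
  have hJ0 : 0 ≤ J := integral_nonneg fun x => by positivity
  have hIntg : ∀ (t : ℝ) (k n : ℕ), (k : ℕ∞) ≤ 0 → (n : ℕ∞) ≤ (4 : ℕ) →
      Integrable (fun v : (EuclideanSpace ℝ (Fin 3)) => ‖v‖ ^ k * ‖iteratedFDeriv ℝ n (fun x : (EuclideanSpace ℝ (Fin 3)) => f (t, x)) v‖) := by
    intro t k n hk hn
    have hk : k = 0 := by simpa using hk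
    have hn : n ≤ 4 := by exact_mod_cast hn
    subst hk
    refine ((integrable_japanese 4 le_rfl).const_mul (C * ((1 + |t|) ^ 4)⁻¹)).mono' ?_ ?_
    · have := (slice_contDiff f t 4).continuous_iteratedFDeriv (m := n) (by exact_mod_cast hn)
      exact (by fun_prop : Continuous fun v : (EuclideanSpace ℝ (Fin 3)) => ‖v‖ ^ 0 * ‖iteratedFDeriv ℝ n (fun x : (EuclideanSpace ℝ (Fin 3)) => f (t, x)) v‖).aestronglyMeasurable
    · refine Filter.Eventually.of_forall fun v => ?_
      simpa using hb n hn t v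
  have hI : ∀ (t : ℝ) (n : ℕ), n ≤ 4 →
      ∫ v : (EuclideanSpace ℝ (Fin 3)), ‖v‖ ^ 0 * ‖iteratedFDeriv ℝ n (fun x : (EuclideanSpace ℝ (Fin 3)) => f (t, x)) v‖ ≤
        C * ((1 + |t|) ^ 4)⁻¹ * J := by
    intro t n hn
    rw [hJ, ← integral_const_mul]
    refine integral_mono (hIntg t 0 n (by simp) (by exact_mod_cast hn))
      ((integrable_japanese 4 le_rfl).const_mul _) fun v => ?_
    simpa using hb n hn t v
  have hF : ∀ (t : ℝ) (w : (EuclideanSpace ℝ (Fin 3))) (n : ℕ), n ≤ 4 →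
      ‖w‖ ^ n * ‖FourierTransform.fourier (fun x : (EuclideanSpace ℝ (Fin 3)) => f (t, x)) w‖ ≤
        2 ^ 4 * (5 * (C * ((1 + |t|) ^ 4)⁻¹ * J)) := by
    intro t w n hn
    have := Real.pow_mul_norm_iteratedFDeriv_fourier_le (K := 0) (N := (4 : ℕ))
      (slice_contDiff f t (4 : ℕ)) (hIntg t) (k := 0) (n := n) (by simp) (by exact_mod_cast hn) w
    rw [norm_iteratedFDeriv_zero] at this
    refine this.trans ?_
    have hs : ∑ p ∈ Finset.range (0 + 1) ×ˢ Finset.range (n + 1),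
        ∫ v : (EuclideanSpace ℝ (Fin 3)), ‖v‖ ^ p.1 * ‖iteratedFDeriv ℝ p.2 (fun x : (EuclideanSpace ℝ (Fin 3)) => f (t, x)) v‖ ≤
        5 * (C * ((1 + |t|) ^ 4)⁻¹ * J) := by
      rw [Finset.sum_product]
      simp only [zero_add, Finset.range_one, Finset.sum_singleton]
      refine (Finset.sum_le_sum (fun i hi => hI t i (by
        have := Finset.mem_range.mp hi; omega))).trans ?_
      rw [Finset.sum_const, Finset.card_range, nsmul_eq_mul]
      have : ((n + 1 : ℕ) : ℝ) ≤ 5 := by exact_mod_cast (by omega : n + 1 ≤ 5)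
      gcongr
    have h2 : ((2 : ℝ) * Real.pi) ^ 0 * (2 * ((0 : ℕ) : ℝ) + 2) ^ n ≤ 2 ^ 4 := by
      simp only [pow_zero, one_mul, Nat.cast_zero, mul_zero, zero_add]
      exact pow_le_pow_right₀ (by norm_num) hn
    exact mul_le_mul h2 hs (Finset.sum_nonneg fun p _ => integral_nonneg fun v => by positivity)
      (by norm_num)
  refine ⟨(2 * Real.pi) ^ 4 * 8 * (2 * (2 ^ 4 * (5 * (C * J)))), by positivity, fun t ξ => ?_⟩
  rw [fourierTf_eq_fourier]
  set w : (EuclideanSpace ℝ (Fin 3)) := (2 * Real.pi)⁻¹ • ξ with hw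
  have hpi : 1 ≤ 2 * Real.pi := by linarith [Real.pi_gt_three]
  have hξ : ‖ξ‖ = 2 * Real.pi * ‖w‖ := by
    rw [hw, norm_smul, norm_inv, Real.norm_of_nonneg (by positivity)]
    field_simp
  set A := ‖FourierTransform.fourier (fun x : (EuclideanSpace ℝ (Fin 3)) => f (t, x)) w‖ with hA
  have hA0 : 0 ≤ A := norm_nonneg _
  have e0 := hF t w 0 (by norm_num)
  have e4 := hF t w 4 (by norm_num)
  rw [← hA] at e0 e4
  rw [← div_eq_mul_inv _ ((1 + ‖ξ‖) ^ 4), le_div_iff₀ (by positivity)]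
  have k1 : (1 + ‖ξ‖) ^ 4 ≤ (2 * Real.pi) ^ 4 * (8 * (1 + ‖w‖ ^ 4)) := by
    have : 1 + ‖ξ‖ ≤ (2 * Real.pi) * (1 + ‖w‖) := by rw [hξ]; linarith
    calc (1 + ‖ξ‖) ^ 4 ≤ ((2 * Real.pi) * (1 + ‖w‖)) ^ 4 := by gcongr
      _ = (2 * Real.pi) ^ 4 * (1 + ‖w‖) ^ 4 := by ring
      _ ≤ _ := by
        gcongr
        have := add_pow_le (zero_le_one) (norm_nonneg w) 4
        norm_num at this ⊢
        exact this
  calc A * (1 + ‖ξ‖) ^ 4 ≤ A * ((2 * Real.pi) ^ 4 * (8 * (1 + ‖w‖ ^ 4))) := by gcongr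
    _ = (2 * Real.pi) ^ 4 * 8 * (‖w‖ ^ 0 * A + ‖w‖ ^ 4 * A) := by ring
    _ ≤ (2 * Real.pi) ^ 4 * 8 * (2 ^ 4 * (5 * (C * ((1 + |t|) ^ 4)⁻¹ * J)) +
        2 ^ 4 * (5 * (C * ((1 + |t|) ^ 4)⁻¹ * J))) := by gcongr
    _ = _ := by ring

lemma measurable_fourier_slice (f : SchwartzMap (ℝ × (EuclideanSpace ℝ (Fin 3))) ℂ) :
    Measurable (fun q : ℝ × (EuclideanSpace ℝ (Fin 3)) => fourierTf (fun x : (EuclideanSpace ℝ (Fin 3)) => f (q.1, x)) q.2) := by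
  have : StronglyMeasurable (fun r : (ℝ × (EuclideanSpace ℝ (Fin 3))) × (EuclideanSpace ℝ (Fin 3)) =>
      Complex.exp (-Complex.I * Complex.ofReal ⟪r.2, r.1.2⟫) * f (r.1.1, r.2)) := by
    refine Continuous.stronglyMeasurable ?_
    have := f.continuous
    fun_prop
  exact (this.integral_prod_right' (ν := volume)).measurable


def gSl (f : SchwartzMap (ℝ × (EuclideanSpace ℝ (Fin 3))) ℂ) (t : ℝ) (ξ : (EuclideanSpace ℝ (Fin 3))) : ℂ := fourierTf (fun x : (EuclideanSpace ℝ (Fin 3)) => f (t, x)) ξ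

def gMod (lam : ℝ) (f : SchwartzMap (ℝ × (EuclideanSpace ℝ (Fin 3))) ℂ) (t : ℝ) (ξ : (EuclideanSpace ℝ (Fin 3))) : ℂ :=
  phs lam (-t, 0) ξ * gSl f t ξ

lemma enorm_gMod (lam : ℝ) (f : SchwartzMap (ℝ × (EuclideanSpace ℝ (Fin 3))) ℂ) (t : ℝ) (ξ : (EuclideanSpace ℝ (Fin 3))) :
    ‖gMod lam f t ξ‖ₑ = ‖gSl f t ξ‖ₑ := by
  rw [gMod, enorm_mul, ← ofReal_norm (phs lam (-t, 0) ξ), norm_phs, ENNReal.ofReal_one, one_mul]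

lemma measurable_gSl (f : SchwartzMap (ℝ × (EuclideanSpace ℝ (Fin 3))) ℂ) :
    Measurable (fun q : ℝ × (EuclideanSpace ℝ (Fin 3)) => gSl f q.1 q.2) := measurable_fourier_slice f

lemma measurable_gMod (lam : ℝ) (f : SchwartzMap (ℝ × (EuclideanSpace ℝ (Fin 3))) ℂ) :
    Measurable (fun q : ℝ × (EuclideanSpace ℝ (Fin 3)) => gMod lam f q.1 q.2) := by
  have h := measurable_gSl f
  exact (measurable_phs lam (f := fun q : ℝ × (EuclideanSpace ℝ (Fin 3)) => ((-q.1, 0) : ℝ × (EuclideanSpace ℝ (Fin 3)))) (g := fun q => q.2)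
    (by fun_prop) measurable_snd).mul h

lemma measurable_slice_left {α β γ : Type*} [MeasurableSpace α] [MeasurableSpace β]
    [MeasurableSpace γ] (u : α → β → γ) (h0 : Measurable fun q : α × β => u q.1 q.2) (t : α) :
    Measurable (u t) :=
  h0.comp (measurable_prodMk_left (x := t))

lemma measurable_gSl_left (f : SchwartzMap (ℝ × (EuclideanSpace ℝ (Fin 3))) ℂ) (t : ℝ) : Measurable (gSl f t) :=
  measurable_slice_left (gSl f) (measurable_gSl f) t

lemma measurable_gMod_left (lam : ℝ) (f : SchwartzMap (ℝ × (EuclideanSpace ℝ (Fin 3))) ℂ) (t : ℝ) :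
    Measurable (gMod lam f t) :=
  measurable_slice_left (gMod lam f) (measurable_gMod lam f) t

lemma integrable_gSl (f : SchwartzMap (ℝ × (EuclideanSpace ℝ (Fin 3))) ℂ) (t : ℝ) : Integrable (gSl f t) := by
  obtain ⟨C, hC, hb⟩ := fourier_slice_decay f
  have hm : Measurable (gSl f t) := measurable_gSl_left f t
  exact ((integrable_japanese 4 le_rfl).const_mul (C * ((1 + |t|) ^ 4)⁻¹)).mono'
    hm.aestronglyMeasurable (Filter.Eventually.of_forall fun ξ => hb t ξ)

lemma integrable_gMod (lam : ℝ) (f : SchwartzMap (ℝ × (EuclideanSpace ℝ (Fin 3))) ℂ) (t : ℝ) :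
    Integrable (gMod lam f t) := by
  have hm : Measurable (gMod lam f t) := measurable_gMod_left lam f t
  refine (integrable_gSl f t).mono hm.aestronglyMeasurable (Filter.Eventually.of_forall fun ξ => ?_)
  rw [gMod, norm_mul, norm_phs, one_mul]

lemma sq_gSl_bound (f : SchwartzMap (ℝ × (EuclideanSpace ℝ (Fin 3))) ℂ) : ∃ C : ℝ, 0 ≤ C ∧ ∀ t ξ,
    ‖ξ‖ ^ 2 * ‖gSl f t ξ‖ ^ 2 ≤ (C * ((1 + |t|) ^ 4)⁻¹) ^ 2 * ((1 + ‖ξ‖) ^ 6)⁻¹ := by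
  obtain ⟨C, hC, hb⟩ := fourier_slice_decay f
  refine ⟨C, hC, fun t ξ => ?_⟩
  have h1 := hb t ξ
  have h0 : 0 < 1 + ‖ξ‖ := by positivity
  calc ‖ξ‖ ^ 2 * ‖gSl f t ξ‖ ^ 2 ≤ (1 + ‖ξ‖) ^ 2 * (C * ((1 + |t|) ^ 4)⁻¹ * ((1 + ‖ξ‖) ^ 4)⁻¹) ^ 2 := by
        have : ‖gSl f t ξ‖ ≤ C * ((1 + |t|) ^ 4)⁻¹ * ((1 + ‖ξ‖) ^ 4)⁻¹ := h1
        gcongr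
        linarith
    _ = _ := by field_simp

lemma integrable_sq_gSl (f : SchwartzMap (ℝ × (EuclideanSpace ℝ (Fin 3))) ℂ) (t : ℝ) :
    Integrable (fun ξ : (EuclideanSpace ℝ (Fin 3)) => ‖ξ‖ ^ 2 * ‖gSl f t ξ‖ ^ 2) := by
  obtain ⟨C, hC, hb⟩ := sq_gSl_bound f
  have hm : Measurable (gSl f t) := measurable_gSl_left f t
  refine ((integrable_japanese 6 (by norm_num)).const_mul ((C * ((1 + |t|) ^ 4)⁻¹) ^ 2)).mono'
    (by fun_prop) (Filter.Eventually.of_forall fun ξ => ?_)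
  rw [Real.norm_of_nonneg (by positivity)]
  exact hb t ξ

lemma sobolevNorm_eq (f : SchwartzMap (ℝ × (EuclideanSpace ℝ (Fin 3))) ℂ) (t : ℝ) :
    sobolevNorm 1 (fun x : (EuclideanSpace ℝ (Fin 3)) => f (t, x)) =
      (∫ ξ : (EuclideanSpace ℝ (Fin 3)), ‖ξ‖ ^ 2 * ‖gSl f t ξ‖ ^ 2) ^ (1/2 : ℝ) := by
  unfold sobolevNorm gSl
  congr 2
  funext ξ
  congr 1
  rw [mul_one, show (2 : ℝ) = ((2 : ℕ) : ℝ) by norm_num, Real.rpow_natCast]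

lemma ofReal_sobolevNorm (f : SchwartzMap (ℝ × (EuclideanSpace ℝ (Fin 3))) ℂ) (t : ℝ) :
    (∫⁻ ξ : (EuclideanSpace ℝ (Fin 3)), ‖ξ‖ₑ ^ 2 * ‖gSl f t ξ‖ₑ ^ 2) ^ (1/2 : ℝ) =
      ENNReal.ofReal (sobolevNorm 1 (fun x : (EuclideanSpace ℝ (Fin 3)) => f (t, x))) := by
  rw [sobolevNorm_eq, ← ENNReal.ofReal_rpow_of_nonneg (integral_nonneg fun ξ => by positivity)
    (by norm_num), ofReal_integral_eq_lintegral_ofReal (integrable_sq_gSl f t)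
    (Filter.Eventually.of_forall fun ξ => by positivity)]
  congr 2
  funext ξ
  rw [ENNReal.ofReal_mul (by positivity), ENNReal.ofReal_pow (norm_nonneg _),
    ENNReal.ofReal_pow (norm_nonneg _), ofReal_norm, ofReal_norm]

lemma sobolevNorm_nonneg (f : SchwartzMap (ℝ × (EuclideanSpace ℝ (Fin 3))) ℂ) (t : ℝ) :
    0 ≤ sobolevNorm 1 (fun x : (EuclideanSpace ℝ (Fin 3)) => f (t, x)) := by
  rw [sobolevNorm_eq]
  exact Real.rpow_nonneg (integral_nonneg fun ξ => by positivity) _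

lemma measurable_sq_lint (f : SchwartzMap (ℝ × (EuclideanSpace ℝ (Fin 3))) ℂ) :
    Measurable (fun t : ℝ => (∫⁻ ξ : (EuclideanSpace ℝ (Fin 3)), ‖ξ‖ₑ ^ 2 * ‖gSl f t ξ‖ₑ ^ 2) ^ (1/2 : ℝ)) := by
  have h := measurable_gSl f
  have : Measurable (fun q : ℝ × (EuclideanSpace ℝ (Fin 3)) => ‖q.2‖ₑ ^ 2 * ‖gSl f q.1 q.2‖ₑ ^ 2) := by fun_prop
  exact this.lintegral_prod_right'.pow_const _

lemma integrable_sobolevNorm (f : SchwartzMap (ℝ × (EuclideanSpace ℝ (Fin 3))) ℂ) :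
    Integrable (fun t : ℝ => sobolevNorm 1 (fun x : (EuclideanSpace ℝ (Fin 3)) => f (t, x))) := by
  obtain ⟨C, hC, hb⟩ := sq_gSl_bound f
  have hm : Measurable (fun t : ℝ => sobolevNorm 1 (fun x : (EuclideanSpace ℝ (Fin 3)) => f (t, x))) := by
    have := (measurable_sq_lint f).ennreal_toReal
    convert this using 2 with t
    rw [ofReal_sobolevNorm, ENNReal.toReal_ofReal (sobolevNorm_nonneg f t)]
  set J : ℝ := ∫ ξ : (EuclideanSpace ℝ (Fin 3)), ((1 + ‖ξ‖) ^ 6)⁻¹ with hJ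
  have hJ0 : 0 ≤ J := integral_nonneg fun ξ => by positivity
  refine ((integrable_japanese1 4 (by norm_num)).const_mul (C * J ^ (1/2 : ℝ))).mono'
    hm.aestronglyMeasurable (Filter.Eventually.of_forall fun t => ?_)
  rw [Real.norm_of_nonneg (sobolevNorm_nonneg f t), sobolevNorm_eq]
  have h1 : ∫ ξ : (EuclideanSpace ℝ (Fin 3)), ‖ξ‖ ^ 2 * ‖gSl f t ξ‖ ^ 2 ≤ (C * ((1 + |t|) ^ 4)⁻¹) ^ 2 * J := by
    rw [hJ, ← integral_const_mul]
    exact integral_mono (integrable_sq_gSl f t)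
      ((integrable_japanese 6 (by norm_num)).const_mul _) fun ξ => hb t ξ
  calc _ ≤ ((C * ((1 + |t|) ^ 4)⁻¹) ^ 2 * J) ^ (1/2 : ℝ) :=
        Real.rpow_le_rpow (integral_nonneg fun ξ => by positivity) h1 (by norm_num)
    _ = C * ((1 + |t|) ^ 4)⁻¹ * J ^ (1/2 : ℝ) := by
        rw [Real.mul_rpow (by positivity) hJ0, ← Real.sqrt_eq_rpow, Real.sqrt_sq (by positivity)]
    _ = _ := by ring

lemma lintegral_sobolev (f : SchwartzMap (ℝ × (EuclideanSpace ℝ (Fin 3))) ℂ) :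
    ∫⁻ t : ℝ, (∫⁻ ξ : (EuclideanSpace ℝ (Fin 3)), ‖ξ‖ₑ ^ 2 * ‖gSl f t ξ‖ₑ ^ 2) ^ (1/2 : ℝ) =
      ENNReal.ofReal (∫ t : ℝ, sobolevNorm 1 (fun x : (EuclideanSpace ℝ (Fin 3)) => f (t, x))) := by
  rw [ofReal_integral_eq_lintegral_ofReal (integrable_sobolevNorm f)
    (Filter.Eventually.of_forall fun t => sobolevNorm_nonneg f t)]
  simp only [ofReal_sobolevNorm]

lemma inner_eq_Wg (ε sgn : ℝ) (f : SchwartzMap (ℝ × (EuclideanSpace ℝ (Fin 3))) ℂ) (p : ℝ × (EuclideanSpace ℝ (Fin 3))) (t : ℝ) :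
    ∫ ξ : (EuclideanSpace ℝ (Fin 3)), Complex.exp (Complex.I *
        Complex.ofReal (⟪p.2, ξ⟫ + sgn * ((p.1 - t) / ε) * pRot ξ)) *
          fourierTf (fun x => f (t, x)) ξ = Wg (sgn / ε) (gMod (sgn / ε) f t) p := by
  unfold Wg
  congr 1
  funext ξ
  rw [gMod, ← mul_assoc, gSl]
  congr 1
  rw [phs, phs, ← Complex.exp_add, ← mul_add, ← Complex.ofReal_add]
  congr 3
  simp only [inner_zero_left]
  ring

lemma measurable_Wg_joint (lam : ℝ) (f : SchwartzMap (ℝ × (EuclideanSpace ℝ (Fin 3))) ℂ) :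
    Measurable (fun q : (ℝ × (EuclideanSpace ℝ (Fin 3))) × ℝ => Wg lam (gMod lam f q.2) q.1) := by
  have h2 : Measurable fun r : ((ℝ × (EuclideanSpace ℝ (Fin 3))) × ℝ) × (EuclideanSpace ℝ (Fin 3)) => gMod lam f r.1.2 r.2 := by
    have h0 := measurable_gMod lam f
    generalize gMod lam f = u at *
    fun_prop
  have h : Measurable (fun r : ((ℝ × (EuclideanSpace ℝ (Fin 3))) × ℝ) × (EuclideanSpace ℝ (Fin 3)) => phs lam r.1.1 r.2 * gMod lam f r.1.2 r.2) :=
    (measurable_phs lam (f := fun r : ((ℝ × (EuclideanSpace ℝ (Fin 3))) × ℝ) × (EuclideanSpace ℝ (Fin 3)) => r.1.1) (g := fun r => r.2)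
      (by fun_prop) measurable_snd).mul h2
  exact (StronglyMeasurable.integral_prod_right' h.stronglyMeasurable).measurable

lemma L6_bound (lam : ℝ) (f : SchwartzMap (ℝ × (EuclideanSpace ℝ (Fin 3))) ℂ) :
    ∫⁻ p : ℝ × (EuclideanSpace ℝ (Fin 3)), (∫⁻ t : ℝ, ‖Wg lam (gMod lam f t) p‖ₑ) ^ 6 ≤
      (ENNReal.ofReal (∫ t : ℝ, sobolevNorm 1 (fun x : (EuclideanSpace ℝ (Fin 3)) => f (t, x))) *
        (224 * rieszK lam * (16 * (16 * (16 * 16)))) ^ (1/2 : ℝ)) ^ 6 := by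
  have hj := (measurable_Wg_joint lam f).enorm
  refine dual_to_L6 volume _ hj.lintegral_prod_right' _ fun G hG hGi hGf => ?_
  have e1 : ∫⁻ p : ℝ × (EuclideanSpace ℝ (Fin 3)), (∫⁻ t : ℝ, ‖Wg lam (gMod lam f t) p‖ₑ) * G p =
      ∫⁻ t : ℝ, ∫⁻ p : ℝ × (EuclideanSpace ℝ (Fin 3)), ‖Wg lam (gMod lam f t) p‖ₑ * G p := by
    rw [← lintegral_lintegral_swap]
    · refine lintegral_congr fun p => ?_
      rw [lintegral_mul_const]
      exact measurable_slice_left (fun (p : ℝ × (EuclideanSpace ℝ (Fin 3))) (t : ℝ) => ‖Wg lam (gMod lam f t) p‖ₑ) hj p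
    · have h2 : Measurable (fun q : (ℝ × (EuclideanSpace ℝ (Fin 3))) × ℝ => G q.1) := hG.comp measurable_fst
      exact (Measurable.mul hj h2).aemeasurable
  refine (le_of_eq e1).trans ?_
  calc ∫⁻ t : ℝ, ∫⁻ p : ℝ × (EuclideanSpace ℝ (Fin 3)), ‖Wg lam (gMod lam f t) p‖ₑ * G p
      ≤ ∫⁻ t : ℝ, (∫⁻ ξ : (EuclideanSpace ℝ (Fin 3)), ‖ξ‖ₑ ^ 2 * ‖gSl f t ξ‖ₑ ^ 2) ^ (1/2 : ℝ) *
        ((224 * rieszK lam * (16 * (16 * (16 * 16)))) ^ (1/2 : ℝ) *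
        (∫⁻ p, G p ^ (6/5 : ℝ)) ^ (5/6 : ℝ)) := by
        refine lintegral_mono fun t => ?_
        have := dual_abs lam G hG hGi hGf (gMod lam f t)
          (measurable_gMod_left lam f t)
          (integrable_gMod lam f t)
        simpa only [enorm_gMod] using this
    _ = _ := by
        rw [lintegral_mul_const _ (measurable_sq_lint f), lintegral_sobolev]
        exact (mul_assoc _ _ _).symm

lemma const_eq (ε sgn : ℝ) (hε : 0 < ε) (hs : sgn = 1 ∨ sgn = -1) :
    (224 * rieszK (sgn / ε) * (16 * (16 * (16 * 16)))) ^ (1/2 : ℝ) =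
      ENNReal.ofReal ((224 * (16 * (16 * (16 * 16)))) ^ (1/2 : ℝ) * ε ^ (1/6 : ℝ)) := by
  have ha : |sgn / ε| = ε⁻¹ := by
    rcases hs with rfl | rfl
    · rw [abs_of_pos (by positivity)]; simp
    · rw [neg_div, abs_neg, abs_of_pos (by positivity)]; simp
  have hne : sgn / ε ≠ 0 := by
    rw [← abs_pos, ha]; positivity
  have h1 : rieszK (sgn / ε) = ENNReal.ofReal (ε ^ (1/3 : ℝ)) := by
    rw [rieszK_eq _ hne, ha, Real.inv_rpow hε.le, ← Real.rpow_neg hε.le, neg_neg]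
  have h2 : (224 * rieszK (sgn / ε) * (16 * (16 * (16 * 16)))) =
      ENNReal.ofReal ((224 * (16 * (16 * (16 * 16)))) * ε ^ (1/3 : ℝ)) := by
    rw [ENNReal.ofReal_mul (by norm_num), h1, ENNReal.ofReal_mul (by norm_num),
      ENNReal.ofReal_mul (by norm_num), ENNReal.ofReal_mul (by norm_num),
      ENNReal.ofReal_mul (by norm_num)]
    simp only [ENNReal.ofReal_ofNat]
    ring
  rw [h2, ENNReal.ofReal_rpow_of_nonneg (by positivity) (by norm_num),
    Real.mul_rpow (by norm_num) (by positivity), ← Real.rpow_mul hε.le]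
  norm_num

theorem strichartz_rotating_euler_inhomogeneous :
    ∃ C : ℝ, 0 < C ∧ ∀ ε : ℝ, 0 < ε → ∀ sgn : ℝ, (sgn = 1 ∨ sgn = -1) →
      ∀ f : SchwartzMap (ℝ × EuclideanSpace ℝ (Fin 3)) ℂ,
        eLpNorm (fun p : ℝ × EuclideanSpace ℝ (Fin 3) =>
            ∫ t' in (0 : ℝ)..p.1,
              ∫ ξ : EuclideanSpace ℝ (Fin 3),
                Complex.exp (Complex.I *
                  Complex.ofReal (⟪p.2, ξ⟫ + sgn * ((p.1 - t') / ε) * pRot ξ)) *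
                  fourierTf (fun x => f (t', x)) ξ) 6 volume
          ≤ ENNReal.ofReal (C * ε ^ (1 / 6 : ℝ) *
              ∫ t' : ℝ, sobolevNorm 1 (fun x => f (t', x))) := by
  refine ⟨(224 * (16 * (16 * (16 * 16)))) ^ (1/2 : ℝ), by positivity, ?_⟩
  intro ε hε sgn hs f
  simp only [inner_eq_Wg]
  have hb := L6_bound (sgn / ε) f
  rw [const_eq ε sgn hε hs, ← ENNReal.ofReal_mul (integral_nonneg fun t => sobolevNorm_nonneg f t),
    mul_comm (∫ t : ℝ, sobolevNorm 1 (fun x => f (t, x)))] at hb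
  rw [eLpNorm_eq_lintegral_rpow_enorm_toReal (by norm_num) (by norm_num)]
  have h6 : (6 : ℝ≥0∞).toReal = ((6 : ℕ) : ℝ) := by norm_num
  rw [h6]
  simp only [ENNReal.rpow_natCast]
  rw [one_div, ENNReal.rpow_inv_le_iff (by norm_num), ENNReal.rpow_natCast]
  refine le_trans (lintegral_mono fun p => ?_) hb
  gcongr
  rw [intervalIntegral.intervalIntegral_eq_integral_uIoc]
  refine le_trans ?_ (setLIntegral_le_lintegral (Set.uIoc 0 p.1) _)
  refine le_trans (le_of_eq ?_) (enorm_integral_le_lintegral_enorm _)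
  split_ifs <;> simp

end
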